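/- arXiv:1607.02390 — 5 statements merged into one kernel-verified Lean document; each statement's English description precedes it below -/
import Mathlib

section
/- For every integer j ≥ 0: (1) the derivative v' has exactly one zero in the open interval (−((3/2)(jπ+π/2))^(2/3), −((3/2)(jπ+π/3))^(2/3)), and every real zero of v' lies in one of these intervals (for some j ≥ 0); (2) u has exactly one zero in (−((3/2)(jπ+2π/3))^(2/3), −((3/2)(jπ+π/2))^(2/3)), and every real zero of u lies in one of these intervals; (3) v has exactly one zero in (−((3/2)(jπ+π))^(2/3), −((3/2)(jπ+5π/6))^(2/3)), and every real zero of v is either 0 or lies in one of these intervals; (4) u' has exactly one zero in (−((3/2)(jπ+7π/6))^(2/3), −((3/2)(jπ+π))^(2/3)), and every real zero of u' is either 0 or lies in one of these intervals. -/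
open Real Set Filter Topology

/-- A function with positive derivative on `(a, b)` which tends to `0` at `a` is positive at `b`. -/
lemma pos_of_deriv_pos_of_tendsto {F F' : ℝ → ℝ} {a b : ℝ} (hab : a < b)
    (hd : ∀ z ∈ Ioc a b, HasDerivAt F (F' z) z) (hpos : ∀ z ∈ Ioo a b, 0 < F' z)
    (hlim : Tendsto F (𝓝[>] a) (𝓝 0)) : 0 < F b := by
  have hmono : StrictMonoOn F (Ioc a b) := by
    refine strictMonoOn_of_deriv_pos (convex_Ioc a b)
      (fun z hz => (hd z hz).continuousAt.continuousWithinAt) fun z hz => ?_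
    rw [interior_Ioc] at hz
    rw [(hd z (Ioo_subset_Ioc_self hz)).deriv]
    exact hpos z hz
  obtain ⟨m, hm⟩ := exists_between hab
  refine lt_of_le_of_lt (le_of_tendsto hlim ?_)
    (hmono (Ioo_subset_Ioc_self hm) (right_mem_Ioc.2 hab) hm.2)
  filter_upwards [Ioo_mem_nhdsGT hm.1] with z hz
  exact (hmono ⟨hz.1, hz.2.le.trans hm.2.le⟩ (Ioo_subset_Ioc_self hm) hz.2).le

/-- A continuous function which starts positive and becomes nonpositive has a first zero. -/
lemma exists_first_zero {f : ℝ → ℝ} {a c : ℝ} (hf : ContinuousOn f (Ici a)) (ha : 0 < f a)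
    (hac : a ≤ c) (hc : f c ≤ 0) :
    ∃ b, a < b ∧ b ≤ c ∧ f b = 0 ∧ ∀ z ∈ Ico a b, 0 < f z := by
  have hcont : ContinuousOn f (Icc a c) := hf.mono Icc_subset_Ici_self
  obtain ⟨z₀, hz₀, hz₀'⟩ := intermediate_value_Icc' hac hcont ⟨hc, ha.le⟩
  have hcpt : IsCompact (Icc a c ∩ f ⁻¹' {0}) :=
    isCompact_Icc.of_isClosed_subset
      (hcont.preimage_isClosed_of_isClosed isClosed_Icc isClosed_singleton) inter_subset_left
  obtain ⟨b, ⟨hb, hfb⟩, hmin⟩ := hcpt.exists_isLeast ⟨z₀, hz₀, hz₀'⟩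
  have hfb : f b = 0 := hfb
  have hab : a < b := lt_of_le_of_ne hb.1 fun h => by rw [h] at ha; linarith
  refine ⟨b, hab, hb.2, hfb, fun z hz => ?_⟩
  by_contra! hneg
  obtain ⟨y, hy, hfy⟩ := intermediate_value_Icc' hz.1
    (hcont.mono (Icc_subset_Icc_right (hz.2.le.trans hb.2))) ⟨hneg, ha.le⟩
  have := hmin ⟨⟨hy.1, hy.2.trans (hz.2.le.trans hb.2)⟩, hfy⟩
  linarith [hy.2, hz.2]

/-- A continuous function without zeros on an open interval has a constant sign there. -/
lemma pos_or_neg_of_ne_zero {f : ℝ → ℝ} {a b : ℝ} (hf : ContinuousOn f (Ioo a b))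
    (h0 : ∀ z ∈ Ioo a b, f z ≠ 0) : (∀ z ∈ Ioo a b, 0 < f z) ∨ ∀ z ∈ Ioo a b, f z < 0 := by
  by_contra! h
  obtain ⟨⟨x, hx, hfx⟩, y, hy, hfy⟩ := h
  obtain ⟨z, hz, hfz⟩ := isPreconnected_Ioo.intermediate_value hx hy hf ⟨hfx, hfy⟩
  exact h0 z hz hfz

/-- The scaling factor `t ^ (1 / 4)`, where `ζ = (2 / 3) t ^ (3 / 2)`. -/
noncomputable def airyScale (z : ℝ) : ℝ := (3 / 2 * z) ^ ((1 : ℝ) / 6)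

lemma airyScale_pos {z : ℝ} (hz : 0 < z) : 0 < airyScale z := by
  unfold airyScale; positivity

lemma airyScale_zero : airyScale 0 = 0 := by simp [airyScale]

lemma continuous_airyScale : Continuous airyScale := by
  unfold airyScale
  exact (continuous_const.mul continuous_id).rpow_const fun _ => Or.inr (by norm_num)

lemma airyScale_pow_six {z : ℝ} (hz : 0 ≤ z) : airyScale z ^ 6 = 3 / 2 * z := by
  rw [airyScale, ← rpow_natCast, ← rpow_mul (by positivity)]
  norm_num

lemma rpow_two_thirds_eq {z : ℝ} (hz : 0 ≤ z) :
    (3 / 2 * z) ^ ((2 : ℝ) / 3) = airyScale z ^ 4 := by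
  rw [airyScale, ← rpow_natCast, ← rpow_mul (by positivity)]
  norm_num

lemma hasDerivAt_airyScale {z : ℝ} (hz : 0 < z) :
    HasDerivAt airyScale (airyScale z / (6 * z)) z := by
  have h := ((hasDerivAt_id z).const_mul (3 / 2 : ℝ)).rpow_const (p := (1 : ℝ) / 6)
    (Or.inl (by simp; positivity))
  refine h.congr_deriv ?_
  simp only [id, airyScale]
  rw [rpow_sub_one (by positivity)]
  field_simp

/-- The Airy system in the variable `ζ = (2 / 3) (-x) ^ (3 / 2)`. -/
structure AiryPair (P S : ℝ → ℝ) : Prop where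
  contP : ContinuousOn P (Ici 0)
  contS : ContinuousOn S (Ici 0)
  derivP : ∀ z, 0 < z → HasDerivAt P (S z / airyScale z ^ 2) z
  derivS : ∀ z, 0 < z → HasDerivAt S (-(airyScale z ^ 2 * P z)) z

namespace AiryPair

variable {P S : ℝ → ℝ}

lemma neg (h : AiryPair P S) : AiryPair (fun z => -P z) (fun z => -S z) where
  contP := h.contP.neg
  contS := h.contS.neg
  derivP z hz := (h.derivP z hz).neg.congr_deriv (by ring)
  derivS z hz := (h.derivS z hz).neg.congr_deriv (by ring)

lemma hasDerivAt_scaled_fst (h : AiryPair P S) {z : ℝ} (hz : 0 < z) :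
    HasDerivAt (fun z => airyScale z * P z)
      (S z / airyScale z + airyScale z * P z / (6 * z)) z := by
  have hr := (airyScale_pos hz).ne'
  refine ((hasDerivAt_airyScale hz).mul (h.derivP z hz)).congr_deriv ?_
  field_simp
  ring

lemma hasDerivAt_scaled_snd (h : AiryPair P S) {z : ℝ} (hz : 0 < z) :
    HasDerivAt (fun z => S z / airyScale z)
      (-(airyScale z * P z) - S z / airyScale z / (6 * z)) z := by
  have hr := (airyScale_pos hz).ne'
  refine ((h.derivS z hz).div (hasDerivAt_airyScale hz) hr).congr_deriv ?_
  field_simp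

lemma strictMonoOn_fst (h : AiryPair P S) {a b : ℝ} (ha : 0 ≤ a)
    (hS : ∀ z ∈ Ioo a b, 0 < S z) : StrictMonoOn P (Icc a b) := by
  refine strictMonoOn_of_deriv_pos (convex_Icc a b)
    (h.contP.mono fun z hz => ha.trans hz.1) fun z hz => ?_
  rw [interior_Icc] at hz
  have hz0 := ha.trans_lt hz.1
  rw [(h.derivP z hz0).deriv]
  exact div_pos (hS z hz) (pow_pos (airyScale_pos hz0) 2)

lemma strictAntiOn_snd (h : AiryPair P S) {a b : ℝ} (ha : 0 ≤ a)
    (hP : ∀ z ∈ Ioo a b, 0 < P z) : StrictAntiOn S (Icc a b) := by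
  refine strictAntiOn_of_deriv_neg (convex_Icc a b)
    (h.contS.mono fun z hz => ha.trans hz.1) fun z hz => ?_
  rw [interior_Icc] at hz
  have hz0 := ha.trans_lt hz.1
  rw [(h.derivS z hz0).deriv]
  exact neg_neg_of_pos (mul_pos (pow_pos (airyScale_pos hz0) 2) (hP z hz))

lemma tendsto_fst (h : AiryPair P S) {a : ℝ} (ha : 0 ≤ a) : Tendsto P (𝓝[>] a) (𝓝 (P a)) :=
  (h.contP a ha).mono_left (nhdsWithin_mono a fun _ hz => ha.trans (le_of_lt hz))

lemma tendsto_snd (h : AiryPair P S) {a : ℝ} (ha : 0 ≤ a) : Tendsto S (𝓝[>] a) (𝓝 (S a)) :=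
  (h.contS a ha).mono_left (nhdsWithin_mono a fun _ hz => ha.trans (le_of_lt hz))

lemma tendsto_scaled_fst (h : AiryPair P S) {a : ℝ} (ha : 0 ≤ a) (h0 : P a = 0) :
    Tendsto (fun z => airyScale z * P z) (𝓝[>] a) (𝓝 0) := by
  have := (continuous_airyScale.continuousAt.tendsto.mono_left nhdsWithin_le_nhds).mul
    (h.tendsto_fst ha)
  simpa [h0] using this

end AiryPair

lemma tendsto_sin_sub_div_airyScale {a : ℝ} (ha : 0 ≤ a) :
    Tendsto (fun z => sin (z - a) / airyScale z) (𝓝[>] a) (𝓝 0) := by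
  have hlim : Tendsto (fun z => 2 / 3 * airyScale z ^ 5 * ((z - a) / z)) (𝓝[>] a) (𝓝 0) := by
    rcases ha.eq_or_lt with rfl | ha
    · have : Tendsto (fun z => 2 / 3 * airyScale z ^ 5) (𝓝[>] 0) (𝓝 0) := by
        have := ((continuous_airyScale.pow 5).const_mul (2 / 3)).tendsto 0
        simpa [airyScale_zero] using this.mono_left (nhdsWithin_le_nhds (s := Ioi 0))
      refine this.congr' ?_
      filter_upwards [self_mem_nhdsWithin] with z hz
      have : z ≠ 0 := ne_of_gt hz
      field_simp
      simp
    · have : ContinuousAt (fun z => 2 / 3 * airyScale z ^ 5 * ((z - a) / z)) a := by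
        have := continuous_airyScale.continuousAt (x := a)
        fun_prop (disch := exact ha.ne')
      simpa using this.tendsto.mono_left nhdsWithin_le_nhds
  refine squeeze_zero_norm' ?_ hlim
  filter_upwards [self_mem_nhdsWithin] with z hz
  have hz : a < z := hz
  have hz0 := ha.trans_lt hz
  have hr := airyScale_pos hz0
  rw [norm_eq_abs, abs_div, abs_of_pos hr]
  have h1 : |sin (z - a)| ≤ z - a := by
    simpa [abs_of_pos (sub_pos.2 hz)] using abs_sin_le_abs (x := z - a)
  calc |sin (z - a)| / airyScale z ≤ (z - a) / airyScale z := by gcongr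
    _ = 2 / 3 * airyScale z ^ 6 * ((z - a) / z) / airyScale z := by
        rw [airyScale_pow_six hz0.le]; field_simp
    _ = _ := by field_simp

lemma tendsto_div_mul_sin_sub {f : ℝ → ℝ} {a : ℝ} (ha : 0 ≤ a)
    (hf : Tendsto f (𝓝[>] a) (𝓝 0)) :
    Tendsto (fun z => f z / (6 * z) * sin (z - a)) (𝓝[>] a) (𝓝 0) := by
  refine squeeze_zero_norm' ?_ (tendsto_zero_iff_norm_tendsto_zero.1 hf)
  filter_upwards [self_mem_nhdsWithin] with z hz
  have hz : a < z := hz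
  have hz0 := ha.trans_lt hz
  have h1 : |sin (z - a)| ≤ z - a := by
    simpa [abs_of_pos (sub_pos.2 hz)] using abs_sin_le_abs (x := z - a)
  rw [norm_eq_abs, norm_eq_abs, abs_mul, abs_div, abs_of_pos (by positivity : 0 < 6 * z),
    div_mul_eq_mul_div]
  refine div_le_of_le_mul₀ (by positivity) (abs_nonneg _) ?_
  exact mul_le_mul_of_nonneg_left (by linarith) (abs_nonneg _)

namespace AiryPair

variable {P S : ℝ → ℝ}

/-- Both functions can be positive only for less than a quarter period after a zero of `P`. -/
lemma lt_add_pi_div_two (h : AiryPair P S) {a b : ℝ} (ha : 0 ≤ a) (hPa : P a = 0)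
    (hP : ∀ z ∈ Ioo a b, 0 < P z) (hS : ∀ z ∈ Ioo a b, 0 < S z) : b < a + π / 2 := by
  by_contra! hb
  have hpi := pi_pos
  have hc : 0 < a + π / 2 := by positivity
  have hlim : Tendsto (fun z => airyScale z * P z * cos (z - a) -
      S z / airyScale z * sin (z - a)) (𝓝[>] a) (𝓝 0) := by
    have h1 := (h.tendsto_scaled_fst ha hPa).mul
      ((by fun_prop : Continuous fun z => cos (z - a)).continuousAt.tendsto.mono_left
        (nhdsWithin_le_nhds (a := a) (s := Ioi a)))
    have h2 := (h.tendsto_snd ha).mul (tendsto_sin_sub_div_airyScale ha)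
    have h3 := h1.sub h2
    simp only [zero_mul, mul_zero, sub_zero] at h3
    exact h3.congr fun z => by ring
  have key := pos_of_deriv_pos_of_tendsto (b := a + π / 2)
    (F' := fun z => (airyScale z * P z * cos (z - a) +
      S z / airyScale z * sin (z - a)) / (6 * z)) (by linarith) (fun z hz => ?_) (fun z hz => ?_)
    hlim
  · have hSc : 0 ≤ S (a + π / 2) := by
      have := (h.derivS _ hc).continuousAt.tendsto.mono_left
        (nhdsWithin_le_nhds (s := Iio (a + π / 2)))
      refine ge_of_tendsto this ?_
      filter_upwards [Ioo_mem_nhdsLT (by linarith : a < a + π / 2)] with z hz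
      exact (hS z ⟨hz.1, hz.2.trans_le hb⟩).le
    have := div_nonneg hSc (airyScale_pos hc).le
    simp only [add_sub_cancel_left, cos_pi_div_two, sin_pi_div_two] at key
    linarith
  · have hz0 := ha.trans_lt hz.1
    have hsub := (hasDerivAt_id z).sub_const a
    refine (((h.hasDerivAt_scaled_fst hz0).mul hsub.cos).sub
      ((h.hasDerivAt_scaled_snd hz0).mul hsub.sin)).congr_deriv ?_
    simp only [id]
    field_simp
    ring
  · have hz0 := ha.trans_lt hz.1
    have hr := airyScale_pos hz0
    have hc : 0 < cos (z - a) := cos_pos_of_mem_Ioo ⟨by linarith [hz.1], by linarith [hz.2]⟩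
    have hs : 0 < sin (z - a) := sin_pos_of_pos_of_lt_pi (by linarith [hz.1]) (by linarith [hz.2])
    have := hP z ⟨hz.1, hz.2.trans_le hb⟩
    have := hS z ⟨hz.1, hz.2.trans_le hb⟩
    positivity

/-- `P` can be positive only for less than a half period after a zero. -/
lemma lt_add_pi (h : AiryPair P S) {a b : ℝ} (ha : 0 ≤ a) (hPa : P a = 0)
    (hP : ∀ z ∈ Ioo a b, 0 < P z) : b < a + π := by
  by_contra! hb
  have hpi := pi_pos
  have hc : 0 < a + π := by positivity
  have hlim : Tendsto (fun z => airyScale z * P z * cos (z - a) -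
      (S z / airyScale z + airyScale z * P z / (6 * z)) * sin (z - a)) (𝓝[>] a) (𝓝 0) := by
    have h0 := h.tendsto_scaled_fst ha hPa
    have h1 := h0.mul
      ((by fun_prop : Continuous fun z => cos (z - a)).continuousAt.tendsto.mono_left
        (nhdsWithin_le_nhds (a := a) (s := Ioi a)))
    have h2 := (h.tendsto_snd ha).mul (tendsto_sin_sub_div_airyScale ha)
    have h3 := (h1.sub h2).sub (tendsto_div_mul_sin_sub ha h0)
    simp only [zero_mul, mul_zero, sub_zero] at h3
    exact h3.congr fun z => by ring
  have key := pos_of_deriv_pos_of_tendsto (b := a + π)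
    (F' := fun z => 5 / 36 / z ^ 2 * (airyScale z * P z) * sin (z - a)) (by linarith)
    (fun z hz => ?_) (fun z hz => ?_) hlim
  · have hPc : 0 ≤ P (a + π) := by
      have := (h.derivP _ hc).continuousAt.tendsto.mono_left
        (nhdsWithin_le_nhds (s := Iio (a + π)))
      refine ge_of_tendsto this ?_
      filter_upwards [Ioo_mem_nhdsLT (by linarith : a < a + π)] with z hz
      exact (hP z ⟨hz.1, hz.2.trans_le hb⟩).le
    have := mul_nonneg (airyScale_pos hc).le hPc
    simp only [add_sub_cancel_left, cos_pi, sin_pi] at key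
    linarith
  · have hz0 := ha.trans_lt hz.1
    have hsub := (hasDerivAt_id z).sub_const a
    have hp := h.hasDerivAt_scaled_fst hz0
    have hs := h.hasDerivAt_scaled_snd hz0
    refine ((hp.mul hsub.cos).sub ((hs.add (hp.div ((hasDerivAt_id z).const_mul 6)
      (by simp only [id]; positivity))).mul hsub.sin)).congr_deriv ?_
    have hr := (airyScale_pos hz0).ne'
    simp only [id, Pi.add_apply, Pi.div_apply]
    field_simp
    ring
  · have hz0 := ha.trans_lt hz.1
    have hr := airyScale_pos hz0
    have hs : 0 < sin (z - a) := sin_pos_of_pos_of_lt_pi (by linarith [hz.1]) (by linarith [hz.2])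
    have := hP z ⟨hz.1, hz.2.trans_le hb⟩
    positivity

end AiryPair

namespace AiryPair

variable {P S : ℝ → ℝ}

/-- After a zero of `S`, a zero of `P` takes more than a quarter period to appear. -/
lemma add_pi_div_two_lt (h : AiryPair P S) {b d : ℝ} (hb : 0 < b) (hSb : S b = 0) (hbd : b < d)
    (hP : ∀ z ∈ Ioo b d, 0 < P z) (hS : ∀ z ∈ Ioc b d, S z < 0) (hPd : P d = 0) :
    b + π / 2 < d := by
  by_contra! hd
  have hpi := pi_pos
  have hlim : Tendsto (fun z => airyScale z * P z * sin (z - b) +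
      S z / airyScale z * cos (z - b)) (𝓝[>] b) (𝓝 0) := by
    have hcont : ContinuousAt (fun z => airyScale z * P z * sin (z - b) +
        S z / airyScale z * cos (z - b)) b := by
      have h1 := (h.hasDerivAt_scaled_fst hb).continuousAt
      have h2 := (h.hasDerivAt_scaled_snd hb).continuousAt
      fun_prop
    simpa [hSb] using hcont.tendsto.mono_left (nhdsWithin_le_nhds (s := Ioi b))
  have key := pos_of_deriv_pos_of_tendsto
    (F' := fun z => (airyScale z * P z * sin (z - b) -
      S z / airyScale z * cos (z - b)) / (6 * z)) hbd (fun z hz => ?_) (fun z hz => ?_) hlim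
  · have hcos : 0 ≤ cos (d - b) := cos_nonneg_of_mem_Icc ⟨by linarith, by linarith⟩
    have hSd : S d / airyScale d < 0 :=
      div_neg_of_neg_of_pos (hS d ⟨hbd, le_rfl⟩) (airyScale_pos (hb.trans hbd))
    simp only [hPd, mul_zero, zero_mul, zero_add] at key
    nlinarith
  · have hz0 := hb.trans hz.1
    have hsub := (hasDerivAt_id z).sub_const b
    refine (((h.hasDerivAt_scaled_fst hz0).mul hsub.sin).add
      ((h.hasDerivAt_scaled_snd hz0).mul hsub.cos)).congr_deriv ?_
    simp only [id]
    field_simp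
    ring
  · have hz0 := hb.trans hz.1
    have hr := airyScale_pos hz0
    have hc : 0 < cos (z - b) := cos_pos_of_mem_Ioo ⟨by linarith [hz.1], by linarith [hz.2]⟩
    have hs : 0 < sin (z - b) := sin_pos_of_pos_of_lt_pi (by linarith [hz.1]) (by linarith [hz.2])
    have h1 := hP z hz
    have h2 := neg_pos.2 (hS z (Ioo_subset_Ioc_self hz))
    have h3 : 0 < airyScale z * P z * sin (z - b) + -S z / airyScale z * cos (z - b) := by
      positivity
    refine div_pos ?_ (by positivity)
    exact h3.trans_eq (by ring)

/-- Consecutive zeros of `S` are more than a half period apart. -/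
lemma add_pi_lt_of_pos (h : AiryPair P S) {b d : ℝ} (hb : 0 ≤ b)
    (hSb : Tendsto (fun z => S z / airyScale z) (𝓝[>] b) (𝓝 0)) (hbd : b < d)
    (hS : ∀ z ∈ Ioo b d, 0 < S z) (hSd : S d = 0) : b + π < d := by
  by_contra! hd
  have hpi := pi_pos
  have hd0 := hb.trans_lt hbd
  have hlim : Tendsto (fun z => -(S z / airyScale z * cos (z - b) +
      (airyScale z * P z + S z / airyScale z / (6 * z)) * sin (z - b))) (𝓝[>] b) (𝓝 0) := by
    have h1 := hSb.mul
      ((by fun_prop : Continuous fun z => cos (z - b)).continuousAt.tendsto.mono_left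
        (nhdsWithin_le_nhds (a := b) (s := Ioi b)))
    have h2 := ((continuous_airyScale.continuousAt.tendsto.mono_left nhdsWithin_le_nhds).mul
      (h.tendsto_fst hb)).mul
      ((by fun_prop : Continuous fun z => sin (z - b)).continuousAt.tendsto.mono_left
        (nhdsWithin_le_nhds (a := b) (s := Ioi b)))
    have h3 := ((h1.add h2).add (tendsto_div_mul_sin_sub hb hSb)).neg
    simp only [sub_self, sin_zero, zero_mul, mul_zero, add_zero, neg_zero] at h3
    exact h3.congr fun z => by ring
  have key := pos_of_deriv_pos_of_tendsto
    (F' := fun z => 7 / 36 / z ^ 2 * (S z / airyScale z) * sin (z - b)) hbd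
    (fun z hz => ?_) (fun z hz => ?_) hlim
  · have hPd : 0 ≤ P d := by
      by_contra! hneg
      have hev : ∀ᶠ z in 𝓝[<] d, P z < 0 :=
        ((h.derivP d hd0).continuousAt.eventually_lt_const hneg).filter_mono nhdsWithin_le_nhds
      obtain ⟨c, hc, hcP⟩ := (mem_nhdsLT_iff_exists_Ioo_subset' hbd).1 hev
      have hm : max b c < d := max_lt hbd hc
      have hanti := h.neg.strictAntiOn_snd (a := max b c) (b := d) (le_max_of_le_left hb)
        fun z hz => neg_pos.2 (hcP ⟨(le_max_right b c).trans_lt hz.1, hz.2⟩)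
      obtain ⟨m, hm1, hm2⟩ := exists_between hm
      have := hanti ⟨hm1.le, hm2.le⟩ ⟨hm.le, le_rfl⟩ hm2
      have := hS m ⟨(le_max_left b c).trans_lt hm1, hm2⟩
      simp only [hSd] at *
      linarith
    have hs : 0 ≤ sin (d - b) := sin_nonneg_of_nonneg_of_le_pi (by linarith) (by linarith)
    have := mul_nonneg (mul_nonneg (airyScale_pos hd0).le hPd) hs
    simp only [hSd, zero_div, zero_mul, zero_add, add_zero] at key
    linarith
  · have hz0 := hb.trans_lt hz.1
    have hsub := (hasDerivAt_id z).sub_const b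
    have hp := h.hasDerivAt_scaled_fst hz0
    have hs := h.hasDerivAt_scaled_snd hz0
    refine ((hs.mul hsub.cos).add ((hp.add (hs.div ((hasDerivAt_id z).const_mul 6)
      (by simp only [id]; positivity))).mul hsub.sin)).neg.congr_deriv ?_
    have hr := (airyScale_pos hz0).ne'
    simp only [id, Pi.add_apply, Pi.div_apply]
    field_simp
    ring
  · have hz0 := hb.trans_lt hz.1
    have hr := airyScale_pos hz0
    have hs : 0 < sin (z - b) := sin_pos_of_pos_of_lt_pi (by linarith [hz.1]) (by linarith [hz.2])
    have := hS z hz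
    positivity

lemma add_pi_lt (h : AiryPair P S) {b d : ℝ} (hb : 0 < b) (hSb : S b = 0) (hbd : b < d)
    (hS : ∀ z ∈ Ioo b d, S z ≠ 0) (hSd : S d = 0) : b + π < d := by
  have hlim : Tendsto (fun z => S z / airyScale z) (𝓝[>] b) (𝓝 0) := by
    simpa [hSb] using (h.hasDerivAt_scaled_snd hb).continuousAt.tendsto.mono_left
      (nhdsWithin_le_nhds (s := Ioi b))
  rcases pos_or_neg_of_ne_zero (h.contS.mono fun z hz => hb.le.trans hz.1.le) hS with hp | hn
  · exact h.add_pi_lt_of_pos hb.le hlim hbd hp hSd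
  · refine h.neg.add_pi_lt_of_pos hb.le ?_ hbd (fun z hz => neg_pos.2 (hn z hz)) (by simp [hSd])
    simpa [neg_div] using hlim.neg

end AiryPair

/-- `a < d` are consecutive zeros of `P`, and `b` is the zero of `S` between them, with
the bounds on their distances that hold for an Airy pair. -/
structure AiryHalfPeriod (P S : ℝ → ℝ) (a b d : ℝ) : Prop where
  fst_lt : a < b
  lt_fst_add : b < a + π / 2
  snd_add_lt : b + π / 2 < d
  lt_snd_add : d < a + π
  snd_eq_zero : S b = 0
  fst_eq_zero : P d = 0
  fst_ne_zero : ∀ z ∈ Ioo a d, P z ≠ 0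
  snd_ne_zero_left : ∀ z ∈ Ioo a b, S z ≠ 0
  snd_ne_zero_right : ∀ z ∈ Ioc b d, S z ≠ 0

lemma AiryHalfPeriod.of_neg {P S : ℝ → ℝ} {a b d : ℝ}
    (h : AiryHalfPeriod (fun z => -P z) (fun z => -S z) a b d) : AiryHalfPeriod P S a b d where
  fst_lt := h.fst_lt
  lt_fst_add := h.lt_fst_add
  snd_add_lt := h.snd_add_lt
  lt_snd_add := h.lt_snd_add
  snd_eq_zero := by simpa using h.snd_eq_zero
  fst_eq_zero := by simpa using h.fst_eq_zero
  fst_ne_zero z hz := by simpa using h.fst_ne_zero z hz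
  snd_ne_zero_left z hz := by simpa using h.snd_ne_zero_left z hz
  snd_ne_zero_right z hz := by simpa using h.snd_ne_zero_right z hz

namespace AiryPair

variable {P S : ℝ → ℝ}

lemma exists_halfPeriod_of_pos (h : AiryPair P S) {a : ℝ} (ha : 0 ≤ a) (hPa : P a = 0)
    (hSa : 0 < S a) : ∃ b d, AiryHalfPeriod P S a b d := by
  have hpi := pi_pos
  have hPpos : ∀ c, (∀ z ∈ Ioo a c, 0 < S z) → ∀ z ∈ Ioc a c, 0 < P z := fun c hc z hz => by
    have := h.strictMonoOn_fst ha hc ⟨le_rfl, hz.1.le.trans hz.2⟩ ⟨hz.1.le, hz.2⟩ hz.1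
    rwa [hPa] at this
  have hSzero : ∃ c, a ≤ c ∧ S c ≤ 0 := by
    by_contra! hc
    have hS : ∀ z ∈ Ioo a (a + π / 2), 0 < S z := fun z hz => hc z hz.1.le
    exact (h.lt_add_pi_div_two ha hPa
      (fun z hz => hPpos _ hS z (Ioo_subset_Ioc_self hz)) hS).false
  obtain ⟨c, hac, hc⟩ := hSzero
  obtain ⟨b, hab, -, hSb, hSpos⟩ :=
    exists_first_zero (h.contS.mono (Ici_subset_Ici.2 ha)) hSa hac hc
  have hSpos' : ∀ z ∈ Ioo a b, 0 < S z := fun z hz => hSpos z (Ioo_subset_Ico_self hz)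
  have hPab := hPpos b hSpos'
  have hb0 := ha.trans_lt hab
  have hPb := hPab b ⟨hab, le_rfl⟩
  have hPzero : ∃ c, b ≤ c ∧ P c ≤ 0 := by
    by_contra! hc
    refine (h.lt_add_pi (b := a + π) ha hPa fun z hz => ?_).false
    rcases le_total z b with hzb | hzb
    · exact hPab z ⟨hz.1, hzb⟩
    · exact hc z hzb
  obtain ⟨c, hbc, hc⟩ := hPzero
  obtain ⟨d, hbd, -, hPd, hPbd⟩ :=
    exists_first_zero (h.contP.mono (Ici_subset_Ici.2 hb0.le)) hPb hbc hc
  have hPad : ∀ z ∈ Ioo a d, 0 < P z := fun z hz => by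
    rcases le_total z b with hzb | hzb
    · exact hPab z ⟨hz.1, hzb⟩
    · exact hPbd z ⟨hzb, hz.2⟩
  have hSneg : ∀ z ∈ Ioc b d, S z < 0 := fun z hz => by
    have := h.strictAntiOn_snd hb0.le (fun z hz => hPbd z (Ioo_subset_Ico_self hz))
      ⟨le_rfl, hbd.le⟩ ⟨hz.1.le, hz.2⟩ hz.1
    rwa [hSb] at this
  exact ⟨b, d,
    { fst_lt := hab
      lt_fst_add := h.lt_add_pi_div_two ha hPa
        (fun z hz => hPab z (Ioo_subset_Ioc_self hz)) hSpos'
      snd_add_lt := h.add_pi_div_two_lt hb0 hSb hbd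
        (fun z hz => hPbd z (Ioo_subset_Ico_self hz)) hSneg hPd
      lt_snd_add := h.lt_add_pi ha hPa hPad
      snd_eq_zero := hSb
      fst_eq_zero := hPd
      fst_ne_zero := fun z hz => (hPad z hz).ne'
      snd_ne_zero_left := fun z hz => (hSpos' z hz).ne'
      snd_ne_zero_right := fun z hz => (hSneg z hz).ne }⟩

lemma exists_halfPeriod (h : AiryPair P S) {a : ℝ} (ha : 0 ≤ a) (hPa : P a = 0)
    (hSa : S a ≠ 0) : ∃ b d, AiryHalfPeriod P S a b d := by
  rcases hSa.lt_or_gt with hn | hp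
  · obtain ⟨b, d, hbd⟩ := h.neg.exists_halfPeriod_of_pos ha (by simp [hPa]) (neg_pos.2 hn)
    exact ⟨b, d, hbd.of_neg⟩
  · exact h.exists_halfPeriod_of_pos ha hPa hp

/-- The zeros of an Airy pair following a zero `a₀` of `P`, in increasing order. -/
lemma exists_zeros (h : AiryPair P S) {a₀ : ℝ} (ha : 0 ≤ a₀) (hPa : P a₀ = 0) (hSa : S a₀ ≠ 0) :
    ∃ a b : ℕ → ℝ, a 0 = a₀ ∧ ∀ k, AiryHalfPeriod P S (a k) (b k) (a (k + 1)) := by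
  have hex : ∀ a : {a : ℝ // 0 ≤ a ∧ P a = 0 ∧ S a ≠ 0},
      ∃ b, ∃ d : {a : ℝ // 0 ≤ a ∧ P a = 0 ∧ S a ≠ 0}, AiryHalfPeriod P S a b d := by
    rintro ⟨a, ha, hPa, hSa⟩
    obtain ⟨b, d, hbd⟩ := h.exists_halfPeriod ha hPa hSa
    have hbd' : b < d := by linarith [hbd.snd_add_lt, pi_pos]
    exact ⟨b, ⟨d, ha.trans (hbd.fst_lt.trans hbd').le, hbd.fst_eq_zero,
      hbd.snd_ne_zero_right d ⟨hbd', le_rfl⟩⟩, hbd⟩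
  choose β δ hδ using hex
  refine ⟨fun k => δ^[k] ⟨a₀, ha, hPa, hSa⟩, fun k => β (δ^[k] ⟨a₀, ha, hPa, hSa⟩), rfl,
    fun k => ?_⟩
  simp only [Function.iterate_succ_apply']
  exact hδ _

end AiryPair

namespace AiryHalfPeriod

variable {P S : ℝ → ℝ} {a b : ℕ → ℝ}

lemma add_mul_pi_div_two_le (h : ∀ k, AiryHalfPeriod P S (a k) (b k) (a (k + 1))) (k : ℕ) :
    a 0 + k * (π / 2) ≤ a k := by
  induction k with
  | zero => simp
  | succ k ih =>
    push_cast
    linarith [(h k).fst_lt, (h k).snd_add_lt]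

lemma le_add_mul_pi (h : ∀ k, AiryHalfPeriod P S (a k) (b k) (a (k + 1))) (k : ℕ) :
    a k ≤ a 0 + k * π := by
  induction k with
  | zero => simp
  | succ k ih =>
    push_cast
    linarith [(h k).lt_snd_add]

lemma add_mul_pi_le_snd (hA : AiryPair P S) (ha : 0 ≤ a 0)
    (h : ∀ k, AiryHalfPeriod P S (a k) (b k) (a (k + 1))) (k : ℕ) : b 0 + k * π ≤ b k := by
  induction k with
  | zero => simp
  | succ k ih =>
    have hpi := pi_pos
    have hab : 0 < b k := by
      have : 0 ≤ (k : ℝ) * (π / 2) := by positivity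
      linarith [add_mul_pi_div_two_le h k, (h k).fst_lt]
    have h1 := (h k).snd_add_lt
    have h2 := (h (k + 1)).fst_lt
    have := hA.add_pi_lt hab (h k).snd_eq_zero (by linarith) (fun z hz => ?_)
      (h (k + 1)).snd_eq_zero
    · push_cast
      linarith
    · rcases le_or_gt z (a (k + 1)) with hza | hza
      · exact (h k).snd_ne_zero_right z ⟨hz.1, hza⟩
      · exact (h (k + 1)).snd_ne_zero_left z ⟨hza, hz.2⟩

lemma exists_mem_Ioc (h : ∀ k, AiryHalfPeriod P S (a k) (b k) (a (k + 1))) {z : ℝ}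
    (hz : a 0 < z) : ∃ k, z ∈ Ioc (a k) (a (k + 1)) := by
  classical
  have hex : ∃ k, z ≤ a k := by
    obtain ⟨k, hk⟩ := exists_nat_ge ((z - a 0) / (π / 2))
    rw [div_le_iff₀ (by positivity)] at hk
    exact ⟨k, by linarith [add_mul_pi_div_two_le h k]⟩
  have h0 : Nat.find hex ≠ 0 := fun h0 => by
    have := Nat.find_spec hex
    rw [h0] at this
    linarith
  obtain ⟨k, hk⟩ := Nat.exists_eq_succ_of_ne_zero h0
  refine ⟨k, ?_, ?_⟩
  · exact not_le.1 (Nat.find_min hex (by omega : k < Nat.find hex))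
  · simpa [hk] using Nat.find_spec hex

lemma exists_eq_fst (h : ∀ k, AiryHalfPeriod P S (a k) (b k) (a (k + 1))) {z : ℝ}
    (hz : a 0 < z) (hPz : P z = 0) : ∃ k, z = a (k + 1) := by
  obtain ⟨k, hk⟩ := exists_mem_Ioc h hz
  refine ⟨k, hk.2.eq_or_lt.resolve_right fun hlt => (h k).fst_ne_zero z ⟨hk.1, hlt⟩ hPz⟩

lemma exists_eq_snd (h : ∀ k, AiryHalfPeriod P S (a k) (b k) (a (k + 1))) {z : ℝ}
    (hz : a 0 < z) (hSz : S z = 0) : ∃ k, z = b k := by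
  obtain ⟨k, hk⟩ := exists_mem_Ioc h hz
  refine ⟨k, ?_⟩
  by_contra hne
  rcases lt_or_gt_of_ne hne with hlt | hgt
  · exact (h k).snd_ne_zero_left z ⟨hk.1, hlt⟩ hSz
  · exact (h k).snd_ne_zero_right z ⟨hgt, hk.2⟩ hSz

end AiryHalfPeriod

lemma le_of_hasDerivAt_le {f g f' g' : ℝ → ℝ} {T : ℝ} (hf : ∀ t, HasDerivAt f (f' t) t)
    (hg : ∀ t, HasDerivAt g (g' t) t) (h0 : f 0 ≤ g 0) (h : ∀ t ∈ Icc 0 T, f' t ≤ g' t) :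
    ∀ t ∈ Icc 0 T, f t ≤ g t := by
  have hd : ∀ t, HasDerivAt (fun t => g t - f t) (g' t - f' t) t := fun t => (hg t).sub (hf t)
  have hmono : MonotoneOn (fun t => g t - f t) (Icc 0 T) := by
    refine monotoneOn_of_deriv_nonneg (convex_Icc 0 T)
      (fun t _ => (hd t).continuousAt.continuousWithinAt)
      (fun t _ => (hd t).differentiableAt.differentiableWithinAt) fun t ht => ?_
    rw [(hd t).deriv]
    exact sub_nonneg.2 (h t (interior_subset ht))
  intro t ht
  have := hmono ⟨le_rfl, ht.1.trans ht.2⟩ ht ht.1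
  simp only at this
  linarith

lemma hasDerivAt_comp_neg {f f' : ℝ → ℝ} (hf : ∀ x, HasDerivAt f (f' x) x) (t : ℝ) :
    HasDerivAt (fun t => f (-t)) (-f' (-t)) t :=
  ((hf (-t)).comp t (hasDerivAt_neg t)).congr_deriv (by ring)

section Airy

variable {f f' : ℝ → ℝ}

/-- Taylor bounds for the even-type Airy solution on an interval where it is nonnegative. -/
lemma airy_fst_taylor_bounds (hf : ∀ x, HasDerivAt f (f' x) x)
    (hf' : ∀ x, HasDerivAt f' (x * f x) x) (h0 : f 0 = 1) (h0' : f' 0 = 0) {T : ℝ} (hT : 0 ≤ T)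
    (hpos : ∀ t ∈ Icc 0 T, 0 ≤ f (-t)) :
    1 - T ^ 3 / 6 ≤ f (-T) ∧ f (-T) ≤ 1 - T ^ 3 / 6 + T ^ 6 / 180 := by
  have d1 := hasDerivAt_comp_neg hf
  have d2 := hasDerivAt_comp_neg hf'
  have b1 : ∀ t ∈ Icc 0 T, 0 ≤ f' (-t) :=
    le_of_hasDerivAt_le (fun t => hasDerivAt_const t (0 : ℝ)) d2 (by simp [h0'])
      fun t ht => by nlinarith [mul_nonneg ht.1 (hpos t ht)]
  have b2 : ∀ t ∈ Icc 0 T, f (-t) ≤ 1 :=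
    le_of_hasDerivAt_le d1 (fun t => hasDerivAt_const t (1 : ℝ)) (by simp [h0])
      fun t ht => by linarith [b1 t ht]
  have b3 : ∀ t ∈ Icc 0 T, f' (-t) ≤ t ^ 2 / 2 :=
    le_of_hasDerivAt_le d2 (fun t => ((hasDerivAt_id t).pow 2).div_const 2) (by simp [h0'])
      fun t ht => by simp; nlinarith [mul_le_mul_of_nonneg_left (b2 t ht) ht.1]
  have b4 : ∀ t ∈ Icc 0 T, 1 - t ^ 3 / 6 ≤ f (-t) :=
    le_of_hasDerivAt_le (fun t => (((hasDerivAt_id t).pow 3).div_const 6).const_sub 1) d1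
      (by simp [h0]) fun t ht => by simp; linarith [b3 t ht]
  have b5 : ∀ t ∈ Icc 0 T, t ^ 2 / 2 - t ^ 5 / 30 ≤ f' (-t) :=
    le_of_hasDerivAt_le (fun t => (((hasDerivAt_id t).pow 2).div_const 2).sub
      (((hasDerivAt_id t).pow 5).div_const 30)) d2 (by simp [h0'])
      fun t ht => by simp; nlinarith [mul_le_mul_of_nonneg_left (b4 t ht) ht.1]
  have b6 : ∀ t ∈ Icc 0 T, f (-t) ≤ 1 - t ^ 3 / 6 + t ^ 6 / 180 :=
    le_of_hasDerivAt_le d1 (fun t => (((((hasDerivAt_id t).pow 3).div_const 6).const_sub 1).add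
      (((hasDerivAt_id t).pow 6).div_const 180))) (by simp [h0])
      fun t ht => by simp; linarith [b5 t ht]
  exact ⟨b4 T ⟨hT, le_rfl⟩, b6 T ⟨hT, le_rfl⟩⟩

lemma three_le_pow_of_airy_snd_deriv_eq_zero (hf : ∀ x, HasDerivAt f (f' x) x)
    (hf' : ∀ x, HasDerivAt f' (x * f x) x) (h0 : f 0 = 0) (h0' : f' 0 = 1) {T : ℝ} (hT : 0 ≤ T)
    (hz : f' (-T) = 0) : 3 ≤ T ^ 3 := by
  have d1 := hasDerivAt_comp_neg hf
  have d2 := hasDerivAt_comp_neg hf'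
  obtain ⟨R, hR, hRT, hzR, hpos⟩ := exists_first_zero (f := fun t => f' (-t)) (a := 0) (c := T)
    (fun t _ => (d2 t).continuousAt.continuousWithinAt) (by simp [h0']) hT hz.le
  have b0 : ∀ t ∈ Icc 0 R, 0 ≤ f' (-t) := fun t ht => by
    rcases ht.2.eq_or_lt with rfl | hlt
    · exact hzR.ge
    · exact (hpos t ⟨ht.1, hlt⟩).le
  have b1 : ∀ t ∈ Icc 0 R, f (-t) ≤ 0 :=
    le_of_hasDerivAt_le d1 (fun t => hasDerivAt_const t (0 : ℝ)) (by simp [h0])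
      fun t ht => by linarith [b0 t ht]
  have b2 : ∀ t ∈ Icc 0 R, f' (-t) ≤ 1 :=
    le_of_hasDerivAt_le d2 (fun t => hasDerivAt_const t (1 : ℝ)) (by simp [h0'])
      fun t ht => by nlinarith [mul_nonneg ht.1 (neg_nonneg.2 (b1 t ht))]
  have b3 : ∀ t ∈ Icc 0 R, -t ≤ f (-t) :=
    le_of_hasDerivAt_le (fun t => hasDerivAt_neg t) d1 (by simp [h0])
      fun t ht => by linarith [b2 t ht]
  have b4 : ∀ t ∈ Icc 0 R, 1 - t ^ 3 / 3 ≤ f' (-t) :=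
    le_of_hasDerivAt_le (fun t => (((hasDerivAt_id t).pow 3).div_const 3).const_sub 1) d2
      (by simp [h0']) fun t ht => by
        simp; nlinarith [mul_le_mul_of_nonneg_left (b3 t ht) ht.1]
  have h1 := b4 R ⟨hR.le, le_rfl⟩
  have h2 : R ^ 3 ≤ T ^ 3 := pow_le_pow_left₀ hR.le hRT 3
  linarith

lemma airyPair_of_airy (hf : ∀ x, HasDerivAt f (f' x) x)
    (hf' : ∀ x, HasDerivAt f' (x * f x) x) :
    AiryPair (fun z => f (-(3 / 2 * z) ^ ((2 : ℝ) / 3)))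
      (fun z => -f' (-(3 / 2 * z) ^ ((2 : ℝ) / 3))) := by
  have hx : Continuous fun z : ℝ => -(3 / 2 * z) ^ ((2 : ℝ) / 3) :=
    ((continuous_const.mul continuous_id).rpow_const fun _ => Or.inr (by norm_num)).neg
  have hdx : ∀ z : ℝ, 0 < z → HasDerivAt (fun z : ℝ => -(3 / 2 * z) ^ ((2 : ℝ) / 3))
      (-(1 / airyScale z ^ 2)) z := fun z hz => by
    have hr := airyScale_pos hz
    have h6 := airyScale_pow_six hz.le
    have h := (((hasDerivAt_id z).const_mul (3 / 2 : ℝ)).rpow_const (p := (2 : ℝ) / 3)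
      (Or.inl (by simp; positivity))).neg
    refine h.congr_deriv ?_
    simp only [id]
    rw [rpow_sub_one (by positivity), rpow_two_thirds_eq hz.le, ← h6]
    field_simp
  have hfc : Continuous f := continuous_iff_continuousAt.2 fun x => (hf x).continuousAt
  have hfc' : Continuous f' := continuous_iff_continuousAt.2 fun x => (hf' x).continuousAt
  refine ⟨(hfc.comp hx).continuousOn, (hfc'.comp hx).neg.continuousOn, fun z hz => ?_,
    fun z hz => ?_⟩
  · exact ((hf _).comp z (hdx z hz)).congr_deriv (by ring)
  · refine ((hf' _).comp z (hdx z hz)).neg.congr_deriv ?_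
    have hr := (airyScale_pos hz).ne'
    rw [rpow_two_thirds_eq hz.le]
    field_simp

end Airy

/-- Transfers the location of zeros from the variable `ζ = (2 / 3) (-x) ^ (3 / 2)` to `x`. -/
lemma zeros_in_intervals {g : ℝ → ℝ} {α β : ℝ} {c : ℕ → ℝ} (hα : 0 ≤ α) (hβ : β ≤ α + π)
    (hc : ∀ j : ℕ, c j ∈ Ioo (j * π + α) (j * π + β))
    (hg : ∀ j, g (-(3 / 2 * c j) ^ ((2 : ℝ) / 3)) = 0)
    (hall : ∀ z, 0 < z → g (-(3 / 2 * z) ^ ((2 : ℝ) / 3)) = 0 → ∃ j, z = c j) :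
    (∀ j : ℕ, ∃! x : ℝ, x ∈ Ioo (-((3 / 2 * ((j : ℝ) * π + β)) ^ ((2 : ℝ) / 3)))
        (-((3 / 2 * ((j : ℝ) * π + α)) ^ ((2 : ℝ) / 3))) ∧ g x = 0) ∧
      ∀ x < 0, g x = 0 → ∃ j : ℕ, x ∈ Ioo (-((3 / 2 * ((j : ℝ) * π + β)) ^ ((2 : ℝ) / 3)))
        (-((3 / 2 * ((j : ℝ) * π + α)) ^ ((2 : ℝ) / 3))) := by
  have hpi := pi_pos
  have hmem : ∀ j : ℕ, -(3 / 2 * c j) ^ ((2 : ℝ) / 3) ∈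
      Ioo (-((3 / 2 * ((j : ℝ) * π + β)) ^ ((2 : ℝ) / 3)))
        (-((3 / 2 * ((j : ℝ) * π + α)) ^ ((2 : ℝ) / 3))) := fun j => by
    have h0 : 0 ≤ (j : ℝ) * π + α := by positivity
    have h1 := (hc j).1
    have h2 := (hc j).2
    have h3 : 0 ≤ c j := h0.trans h1.le
    exact ⟨neg_lt_neg (rpow_lt_rpow (by positivity) (by linarith) (by norm_num)),
      neg_lt_neg (rpow_lt_rpow (by positivity) (by linarith) (by norm_num))⟩
  have hsurj : ∀ x < 0, g x = 0 → ∃ j, x = -(3 / 2 * c j) ^ ((2 : ℝ) / 3) := fun x hx hgx => by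
    have hx' : -(3 / 2 * (2 / 3 * (-x) ^ ((3 : ℝ) / 2))) ^ ((2 : ℝ) / 3) = x := by
      rw [← mul_assoc, show (3 / 2 * (2 / 3) : ℝ) = 1 by norm_num, one_mul,
        ← rpow_mul (by linarith)]
      norm_num
    obtain ⟨j, hj⟩ := hall (2 / 3 * (-x) ^ ((3 : ℝ) / 2))
      (mul_pos (by norm_num) (rpow_pos_of_pos (neg_pos.2 hx) _)) (by rwa [hx'])
    exact ⟨j, by rw [← hj, hx']⟩
  refine ⟨fun j => ⟨_, ⟨hmem j, hg j⟩, fun x ⟨hx, hgx⟩ => ?_⟩, fun x hx hgx => ?_⟩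
  · have h0 : 0 ≤ (j : ℝ) * π + α := by positivity
    have hx0 : x < 0 := hx.2.trans_le (neg_nonpos.2 (by positivity))
    obtain ⟨k, rfl⟩ := hsurj x hx0 hgx
    have hk0 : 0 ≤ (k : ℝ) * π + α := by positivity
    have hck : 0 ≤ c k := hk0.trans (hc k).1.le
    have h1 := (rpow_lt_rpow_iff (by positivity) (by positivity) (by norm_num)).1
      (neg_lt_neg_iff.1 hx.2)
    have hlt : 0 ≤ (j : ℝ) * π + β := h0.trans ((hc j).1.trans (hc j).2).le
    have h2 := (rpow_lt_rpow_iff (by positivity) (by positivity) (by norm_num)).1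
      (neg_lt_neg_iff.1 hx.1)
    have h3 := (hc k).1
    have h4 := (hc k).2
    have hkj : (k : ℝ) < j + 1 := by
      by_contra! hle
      nlinarith
    have hjk : (j : ℝ) < k + 1 := by
      by_contra! hle
      nlinarith
    have : k = j := by
      have h5 : k < j + 1 := by exact_mod_cast hkj
      have h6 : j < k + 1 := by exact_mod_cast hjk
      omega
    rw [this]
  · obtain ⟨j, rfl⟩ := hsurj x hx hgx
    exact ⟨j, hmem j⟩

/-- A nontrivial Airy solution whose value or derivative vanishes at `0` has no zeros and no
critical points to the right of `0`. -/
lemma airy_mul_deriv_ne_zero {f f' : ℝ → ℝ} (hf : ∀ x, HasDerivAt f (f' x) x)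
    (hf' : ∀ x, HasDerivAt f' (x * f x) x) (h0 : f 0 * f' 0 = 0) (hne : f 0 ≠ 0 ∨ f' 0 ≠ 0)
    {x : ℝ} (hx : 0 < x) : f x * f' x ≠ 0 := by
  intro hq
  have hd : ∀ y, HasDerivAt (fun y => f y * f' y) (f' y ^ 2 + y * f y ^ 2) y := fun y =>
    ((hf y).mul (hf' y)).congr_deriv (by ring)
  have hmono : MonotoneOn (fun y => f y * f' y) (Ici 0) := by
    refine monotoneOn_of_deriv_nonneg (convex_Ici 0)
      (fun y _ => (hd y).continuousAt.continuousWithinAt)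
      (fun y _ => (hd y).differentiableAt.differentiableWithinAt) fun y hy => ?_
    rw [interior_Ici] at hy
    have hy : 0 < y := hy
    rw [(hd y).deriv]
    positivity
  have hzero : ∀ y ∈ Ioo 0 x, f y * f' y = 0 := fun y hy =>
    le_antisymm ((hmono hy.1.le hx.le hy.2.le).trans_eq hq)
      (h0.symm.trans_le (hmono (mem_Ici.2 le_rfl) hy.1.le hy.1.le))
  have hboth : ∀ y ∈ Ioo 0 x, f y = 0 ∧ f' y = 0 := fun y hy => by
    have heq : (fun y => f y * f' y) =ᶠ[𝓝 y] fun _ => 0 := by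
      filter_upwards [Ioo_mem_nhds hy.1 hy.2] with z hz using hzero z hz
    have hsum := (hd y).unique ((hasDerivAt_const y (0 : ℝ)).congr_of_eventuallyEq heq)
    have h1 : 0 ≤ y * f y ^ 2 := mul_nonneg hy.1.le (sq_nonneg _)
    have h2 : y * f y ^ 2 = 0 := by linarith [sq_nonneg (f' y)]
    have h3 : f' y ^ 2 = 0 := by linarith
    exact ⟨by simpa [hy.1.ne'] using h2, by simpa using h3⟩
  have hev := Ioo_mem_nhdsGT hx
  have hlim : ∀ g : ℝ → ℝ, ContinuousAt g 0 → (∀ y ∈ Ioo 0 x, g y = 0) → g 0 = 0 :=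
    fun g hg hg0 => tendsto_nhds_unique (hg.tendsto.mono_left (nhdsWithin_le_nhds (s := Ioi 0)))
      (tendsto_const_nhds.congr' (by filter_upwards [hev] with y hy using (hg0 y hy).symm))
  rcases hne with hne | hne
  · exact hne (hlim f (hf 0).continuousAt fun y hy => (hboth y hy).1)
  · exact hne (hlim f' (hf' 0).continuousAt fun y hy => (hboth y hy).2)

lemma airyScale_pow_four_pow_three {z : ℝ} (hz : 0 ≤ z) :
    (airyScale z ^ 4) ^ 3 = 9 / 4 * z ^ 2 := by
  rw [← pow_mul, show airyScale z ^ (4 * 3) = (airyScale z ^ 6) ^ 2 by ring,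
    airyScale_pow_six hz]
  ring

/-- Location of the zeros of the Airy solution `f` with `f 0 = 0` and of its derivative, in the
variable `ζ = (2 / 3) (-x) ^ (3 / 2)`. -/
lemma airy_odd_zeros {f f' : ℝ → ℝ} (hf : ∀ x, HasDerivAt f (f' x) x)
    (hf' : ∀ x, HasDerivAt f' (x * f x) x) (h0 : f 0 = 0) (h0' : f' 0 = 1) :
    (∃ c : ℕ → ℝ, (∀ j : ℕ, c j ∈ Ioo (j * π + π / 3) (j * π + π / 2)) ∧
      (∀ j, f' (-(3 / 2 * c j) ^ ((2 : ℝ) / 3)) = 0) ∧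
      ∀ z, 0 < z → f' (-(3 / 2 * z) ^ ((2 : ℝ) / 3)) = 0 → ∃ j, z = c j) ∧
    ∃ c : ℕ → ℝ, (∀ j : ℕ, c j ∈ Ioo (j * π + 5 * π / 6) (j * π + π)) ∧
      (∀ j, f (-(3 / 2 * c j) ^ ((2 : ℝ) / 3)) = 0) ∧
      ∀ z, 0 < z → f (-(3 / 2 * z) ^ ((2 : ℝ) / 3)) = 0 → ∃ j, z = c j := by
  have hpair := airyPair_of_airy hf hf'
  obtain ⟨a, b, ha, hper⟩ := hpair.exists_zeros le_rfl (by simp [h0]) (by simp [h0'])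
  have hb0 : π / 3 < b 0 := by
    have hpos : 0 < b 0 := ha ▸ (hper 0).fst_lt
    have hz := (hper 0).snd_eq_zero
    rw [rpow_two_thirds_eq hpos.le, neg_eq_zero] at hz
    have h3 := three_le_pow_of_airy_snd_deriv_eq_zero hf hf' h0 h0'
      (pow_pos (airyScale_pos hpos) 4).le hz
    rw [airyScale_pow_four_pow_three hpos.le] at h3
    nlinarith [pi_lt_d2, pi_pos]
  have hb := AiryHalfPeriod.add_mul_pi_le_snd hpair ha.ge hper
  have hle := AiryHalfPeriod.le_add_mul_pi hper
  refine ⟨⟨b, fun j => ⟨by linarith [hb j], by linarith [hle j, (hper j).lt_fst_add]⟩,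
      fun j => neg_eq_zero.1 (hper j).snd_eq_zero,
      fun z hz hfz => AiryHalfPeriod.exists_eq_snd hper (ha ▸ hz) (neg_eq_zero.2 hfz)⟩,
    fun j => a (j + 1), fun j => ⟨?_, ?_⟩, fun j => (hper j).fst_eq_zero,
    fun z hz hfz => AiryHalfPeriod.exists_eq_fst hper (ha ▸ hz) hfz⟩
  · linarith [hb j, (hper j).snd_add_lt]
  · linarith [hle j, (hper j).lt_snd_add]

lemma airy_even_first_zero {f f' : ℝ → ℝ} (hf : ∀ x, HasDerivAt f (f' x) x)
    (hf' : ∀ x, HasDerivAt f' (x * f x) x) (h0 : f 0 = 1) (h0' : f' 0 = 0) :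
    ∃ a, a ∈ Ioo (π / 2) (2 * π / 3) ∧ f (-(3 / 2 * a) ^ ((2 : ℝ) / 3)) = 0 ∧
      ∀ z ∈ Ico 0 a, 0 < f (-(3 / 2 * z) ^ ((2 : ℝ) / 3)) := by
  have hpair := airyPair_of_airy hf hf'
  have hpi := pi_pos
  have hpos : ∀ a, 0 ≤ a → (∀ z ∈ Icc 0 a, 0 ≤ f (-(3 / 2 * z) ^ ((2 : ℝ) / 3))) →
      ∀ t ∈ Icc 0 (airyScale a ^ 4), 0 ≤ f (-t) := fun a ha h t ht => by
    rw [← rpow_two_thirds_eq ha] at ht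
    have hz := h (2 / 3 * t ^ ((3 : ℝ) / 2)) ⟨by have := ht.1; positivity, ?_⟩
    · rw [← mul_assoc, show (3 / 2 * (2 / 3) : ℝ) = 1 by norm_num, one_mul,
        ← rpow_mul ht.1] at hz
      norm_num at hz
      exact hz
    · have h1 := rpow_le_rpow ht.1 ht.2 (by norm_num : (0 : ℝ) ≤ 3 / 2)
      rw [← rpow_mul (by positivity)] at h1
      norm_num at h1
      linarith
  have hex : ∃ c, 0 ≤ c ∧ c < 2 * π / 3 ∧ f (-(3 / 2 * c) ^ ((2 : ℝ) / 3)) ≤ 0 := by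
    by_contra! hc
    have hT : (0 : ℝ) ≤ 2 * π / 3 := by positivity
    have hnonneg : ∀ z ∈ Icc 0 (2 * π / 3), 0 ≤ f (-(3 / 2 * z) ^ ((2 : ℝ) / 3)) := by
      intro z hz
      rcases hz.2.eq_or_lt with rfl | hlt
      · have := (hpair.derivP _ (by positivity : 0 < 2 * π / 3)).continuousAt.tendsto.mono_left
          (nhdsWithin_le_nhds (s := Iio (2 * π / 3)))
        refine ge_of_tendsto this ?_
        filter_upwards [Ioo_mem_nhdsLT (by positivity : 0 < 2 * π / 3)] with z hz
        exact (hc z hz.1.le hz.2).le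
      · exact (hc z hz.1 hlt).le
    have hr := (pow_nonneg (airyScale_pos (by positivity : 0 < 2 * π / 3)).le 4)
    have h1 := (airy_fst_taylor_bounds hf hf' h0 h0' hr (hpos _ hT hnonneg)).2
    have h2 := hpos _ hT hnonneg _ ⟨hr, le_rfl⟩
    rw [show (airyScale (2 * π / 3) ^ 4) ^ 6 = ((airyScale (2 * π / 3) ^ 4) ^ 3) ^ 2 by ring,
      airyScale_pow_four_pow_three hT] at h1
    have h3 : 9.8 < π ^ 2 := by nlinarith [pi_gt_d2]
    have h4 : π ^ 2 < 10 := by nlinarith [pi_lt_d2]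
    nlinarith
  obtain ⟨c, hc0, hc, hfc⟩ := hex
  obtain ⟨a, ha0, hac, hfa, hfpos⟩ := exists_first_zero hpair.contP (by simp [h0]) hc0 hfc
  refine ⟨a, ⟨?_, hac.trans_lt hc⟩, hfa, hfpos⟩
  have hr := (pow_pos (airyScale_pos ha0) 4).le
  have h1 := (airy_fst_taylor_bounds hf hf' h0 h0' hr (hpos a ha0.le fun z hz => ?_)).1
  · rw [← rpow_two_thirds_eq ha0.le, hfa, rpow_two_thirds_eq ha0.le,
      airyScale_pow_four_pow_three ha0.le] at h1
    nlinarith [pi_lt_d2]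
  · rcases hz.2.eq_or_lt with rfl | hlt
    · exact hfa.ge
    · exact (hfpos z ⟨hz.1, hlt⟩).le

lemma airy_even_tendsto_scaled_snd {f f' : ℝ → ℝ} (hf' : ∀ x, HasDerivAt f' (x * f x) x)
    (h0' : f' 0 = 0) :
    Tendsto (fun z => f' (-(3 / 2 * z) ^ ((2 : ℝ) / 3)) / airyScale z) (𝓝[>] 0) (𝓝 0) := by
  have hslope : Tendsto (fun x => f' x / x) (𝓝[≠] 0) (𝓝 0) := by
    have := (hasDerivAt_iff_tendsto_slope.1 (hf' 0))
    simp only [zero_mul] at this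
    refine this.congr fun x => ?_
    simp [slope_def_field, h0']
  have hscale : Tendsto airyScale (𝓝[>] 0) (𝓝 0) := by
    simpa [airyScale_zero] using
      continuous_airyScale.continuousAt.tendsto.mono_left (nhdsWithin_le_nhds (a := 0) (s := Ioi 0))
  have hx : Tendsto (fun z => -airyScale z ^ 4) (𝓝[>] 0) (𝓝[≠] 0) := by
    refine tendsto_nhdsWithin_iff.2 ⟨by simpa using (hscale.pow 4).neg, ?_⟩
    filter_upwards [self_mem_nhdsWithin] with z hz
    exact neg_ne_zero.2 (pow_pos (airyScale_pos hz) 4).ne'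
  have h := ((hslope.comp hx).mul (hscale.pow 3)).neg
  simp only [zero_mul, neg_zero] at h
  refine h.congr' ?_
  filter_upwards [self_mem_nhdsWithin] with z hz
  have hz : 0 < z := hz
  have hr := (airyScale_pos hz).ne'
  simp only [Function.comp, rpow_two_thirds_eq hz.le]
  field_simp

/-- Location of the zeros of the Airy solution `f` with `f' 0 = 0` and of its derivative, in the
variable `ζ = (2 / 3) (-x) ^ (3 / 2)`. -/
lemma airy_even_zeros {f f' : ℝ → ℝ} (hf : ∀ x, HasDerivAt f (f' x) x)
    (hf' : ∀ x, HasDerivAt f' (x * f x) x) (h0 : f 0 = 1) (h0' : f' 0 = 0) :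
    (∃ c : ℕ → ℝ, (∀ j : ℕ, c j ∈ Ioo (j * π + π / 2) (j * π + 2 * π / 3)) ∧
      (∀ j, f (-(3 / 2 * c j) ^ ((2 : ℝ) / 3)) = 0) ∧
      ∀ z, 0 < z → f (-(3 / 2 * z) ^ ((2 : ℝ) / 3)) = 0 → ∃ j, z = c j) ∧
    ∃ c : ℕ → ℝ, (∀ j : ℕ, c j ∈ Ioo (j * π + π) (j * π + 7 * π / 6)) ∧
      (∀ j, f' (-(3 / 2 * c j) ^ ((2 : ℝ) / 3)) = 0) ∧
      ∀ z, 0 < z → f' (-(3 / 2 * z) ^ ((2 : ℝ) / 3)) = 0 → ∃ j, z = c j := by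
  have hpair := airyPair_of_airy hf hf'
  have hpi := pi_pos
  obtain ⟨a₀, ha₀, hPa, hPpos⟩ := airy_even_first_zero hf hf' h0 h0'
  have ha₀0 : 0 < a₀ := by linarith [ha₀.1]
  have hSpos : ∀ z ∈ Ioc 0 a₀, 0 < f' (-(3 / 2 * z) ^ ((2 : ℝ) / 3)) := fun z hz => by
    have := hpair.strictAntiOn_snd le_rfl (fun z hz => hPpos z (Ioo_subset_Ico_self hz))
      ⟨le_rfl, ha₀0.le⟩ ⟨hz.1.le, hz.2⟩ hz.1
    simpa [h0'] using this
  obtain ⟨a, b, ha, hper⟩ := hpair.exists_zeros ha₀0.le hPa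
    (neg_ne_zero.2 (hSpos a₀ ⟨ha₀0, le_rfl⟩).ne')
  have hb0 : π < b 0 := by
    have hlim := airy_even_tendsto_scaled_snd hf' h0'
    have hab : a₀ < b 0 := ha ▸ (hper 0).fst_lt
    have hne : ∀ z ∈ Ioo 0 (b 0), f' (-(3 / 2 * z) ^ ((2 : ℝ) / 3)) ≠ 0 := fun z hz => by
      rcases le_or_gt z a₀ with hza | hza
      · exact (hSpos z ⟨hz.1, hza⟩).ne'
      · exact neg_ne_zero.1 ((hper 0).snd_ne_zero_left z ⟨ha ▸ hza, hz.2⟩)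
    have hcont : ContinuousOn (fun z => f' (-(3 / 2 * z) ^ ((2 : ℝ) / 3))) (Ioo 0 (b 0)) := by
      simpa using hpair.neg.contS.mono fun z (hz : z ∈ Ioo 0 (b 0)) => hz.1.le
    have hsign := (pos_or_neg_of_ne_zero hcont hne).resolve_right
      fun hn => absurd (hn a₀ ⟨ha₀0, hab⟩) (hSpos a₀ ⟨ha₀0, le_rfl⟩).not_gt
    have := hpair.neg.add_pi_lt_of_pos le_rfl (by simpa using hlim) (ha₀0.trans hab)
      (by simpa using hsign) (by simpa using (hper 0).snd_eq_zero)
    linarith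
  have hb := AiryHalfPeriod.add_mul_pi_le_snd hpair (ha ▸ ha₀0.le) hper
  have hle := AiryHalfPeriod.le_add_mul_pi hper
  rw [ha] at hle
  refine ⟨⟨a, fun j => ⟨?_, by linarith [hle j, ha₀.2]⟩, fun j => ?_, fun z hz hfz => ?_⟩,
    b, fun j => ⟨by linarith [hb j], by linarith [hle j, ha₀.2, (hper j).lt_fst_add]⟩,
    fun j => neg_eq_zero.1 (hper j).snd_eq_zero, fun z hz hfz => ?_⟩
  · cases j with
    | zero => simpa [ha] using ha₀.1
    | succ k =>
      push_cast
      linarith [hb k, (hper k).snd_add_lt]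
  · cases j with
    | zero => rwa [ha]
    | succ k => exact (hper k).fst_eq_zero
  · rcases lt_trichotomy z a₀ with hlt | heq | hgt
    · exact absurd hfz (hPpos z ⟨hz.le, hlt⟩).ne'
    · exact ⟨0, heq.trans ha.symm⟩
    · obtain ⟨k, hk⟩ := AiryHalfPeriod.exists_eq_fst hper (ha ▸ hgt) hfz
      exact ⟨k + 1, hk⟩
  · rcases le_or_gt z a₀ with hza | hza
    · exact absurd hfz (hSpos z ⟨hz, hza⟩).ne'
    · exact AiryHalfPeriod.exists_eq_snd hper (ha ▸ hza) (neg_eq_zero.2 hfz)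

theorem stmt_0 (u v u' v' : ℝ → ℝ)
    (hu : ∀ x, HasDerivAt u (u' x) x)
    (huAiry : ∀ x, HasDerivAt u' (x * u x) x)
    (hv : ∀ x, HasDerivAt v (v' x) x)
    (hvAiry : ∀ x, HasDerivAt v' (x * v x) x)
    (hu0 : u 0 = 1) (hu'0 : u' 0 = 0) (hv0 : v 0 = 0) (hv'0 : v' 0 = 1) :
    ((∀ j : ℕ, ∃! x : ℝ,
        x ∈ Ioo (-(((3:ℝ)/2 * ((j : ℝ) * π + π/2)) ^ ((2:ℝ)/3)))
                (-(((3:ℝ)/2 * ((j : ℝ) * π + π/3)) ^ ((2:ℝ)/3))) ∧ v' x = 0) ∧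
      ∀ x : ℝ, v' x = 0 → ∃ j : ℕ,
        x ∈ Ioo (-(((3:ℝ)/2 * ((j : ℝ) * π + π/2)) ^ ((2:ℝ)/3)))
                (-(((3:ℝ)/2 * ((j : ℝ) * π + π/3)) ^ ((2:ℝ)/3)))) ∧
    ((∀ j : ℕ, ∃! x : ℝ,
        x ∈ Ioo (-(((3:ℝ)/2 * ((j : ℝ) * π + 2*π/3)) ^ ((2:ℝ)/3)))
                (-(((3:ℝ)/2 * ((j : ℝ) * π + π/2)) ^ ((2:ℝ)/3))) ∧ u x = 0) ∧
      ∀ x : ℝ, u x = 0 → ∃ j : ℕ,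
        x ∈ Ioo (-(((3:ℝ)/2 * ((j : ℝ) * π + 2*π/3)) ^ ((2:ℝ)/3)))
                (-(((3:ℝ)/2 * ((j : ℝ) * π + π/2)) ^ ((2:ℝ)/3)))) ∧
    ((∀ j : ℕ, ∃! x : ℝ,
        x ∈ Ioo (-(((3:ℝ)/2 * ((j : ℝ) * π + π)) ^ ((2:ℝ)/3)))
                (-(((3:ℝ)/2 * ((j : ℝ) * π + 5*π/6)) ^ ((2:ℝ)/3))) ∧ v x = 0) ∧
      ∀ x : ℝ, v x = 0 → x = 0 ∨ ∃ j : ℕ,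
        x ∈ Ioo (-(((3:ℝ)/2 * ((j : ℝ) * π + π)) ^ ((2:ℝ)/3)))
                (-(((3:ℝ)/2 * ((j : ℝ) * π + 5*π/6)) ^ ((2:ℝ)/3)))) ∧
    ((∀ j : ℕ, ∃! x : ℝ,
        x ∈ Ioo (-(((3:ℝ)/2 * ((j : ℝ) * π + 7*π/6)) ^ ((2:ℝ)/3)))
                (-(((3:ℝ)/2 * ((j : ℝ) * π + π)) ^ ((2:ℝ)/3))) ∧ u' x = 0) ∧
      ∀ x : ℝ, u' x = 0 → x = 0 ∨ ∃ j : ℕ,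
        x ∈ Ioo (-(((3:ℝ)/2 * ((j : ℝ) * π + 7*π/6)) ^ ((2:ℝ)/3)))
                (-(((3:ℝ)/2 * ((j : ℝ) * π + π)) ^ ((2:ℝ)/3)))) := by
  obtain ⟨⟨c₁, hc₁, hz₁, hall₁⟩, c₃, hc₃, hz₃, hall₃⟩ := airy_odd_zeros hv hvAiry hv0 hv'0
  obtain ⟨⟨c₂, hc₂, hz₂, hall₂⟩, c₄, hc₄, hz₄, hall₄⟩ := airy_even_zeros hu huAiry hu0 hu'0
  have hpi := pi_pos
  have hupos : ∀ x, 0 < x → u x * u' x ≠ 0 := fun x hx =>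
    airy_mul_deriv_ne_zero hu huAiry (by simp [hu'0]) (Or.inl (by simp [hu0])) hx
  have hvpos : ∀ x, 0 < x → v x * v' x ≠ 0 := fun x hx =>
    airy_mul_deriv_ne_zero hv hvAiry (by simp [hv0]) (Or.inr (by simp [hv'0])) hx
  obtain ⟨e₁, l₁⟩ := zeros_in_intervals (by positivity) (by linarith) hc₁ hz₁ hall₁
  obtain ⟨e₂, l₂⟩ := zeros_in_intervals (by positivity) (by linarith) hc₂ hz₂ hall₂
  obtain ⟨e₃, l₃⟩ := zeros_in_intervals (by positivity) (by linarith) hc₃ hz₃ hall₃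
  obtain ⟨e₄, l₄⟩ := zeros_in_intervals (by positivity) (by linarith) hc₄ hz₄ hall₄
  refine ⟨⟨e₁, fun x hx => ?_⟩, ⟨e₂, fun x hx => ?_⟩, ⟨e₃, fun x hx => ?_⟩, ⟨e₄, fun x hx => ?_⟩⟩
  · rcases lt_trichotomy x 0 with hlt | rfl | hgt
    · exact l₁ x hlt hx
    · simp [hv'0] at hx
    · exact absurd (by simp [hx]) (hvpos x hgt)
  · rcases lt_trichotomy x 0 with hlt | rfl | hgt
    · exact l₂ x hlt hx
    · simp [hu0] at hx
    · exact absurd (by simp [hx]) (hupos x hgt)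
  · rcases lt_trichotomy x 0 with hlt | rfl | hgt
    · exact Or.inr (l₃ x hlt hx)
    · exact Or.inl rfl
    · exact absurd (by simp [hx]) (hvpos x hgt)
  · rcases lt_trichotomy x 0 with hlt | rfl | hgt
    · exact Or.inr (l₄ x hlt hx)
    · exact Or.inl rfl
    · exact absurd (by simp [hx]) (hupos x hgt)
end

section
/- The canonical solutions have the following signs and variations: (i) u(x) > 0 for all x > −c̃₀; (ii) for every j ≥ 0 and every x in the open interval (−c̃_{2j+2}, −c̃_{2j}), (−1)^j·u(x) < 0; (iii) u is strictly increasing on (−c̃₁, +∞); (iv) for every j ≥ 0, the function x ↦ (−1)^j·u(x) is strictly decreasing on the interval [−c̃_{2j+3}, −c̃_{2j+1}]; (v) v(x) > 0 for all x > 0 and v(x) < 0 for all x in (−c₁, 0); (vi) for every j ≥ 0 and every x in (−c_{2j+3}, −c_{2j+1}), (−1)^j·v(x) > 0; (vii) v is strictly increasing on (−c₀, +∞); (viii) for every j ≥ 0, the function x ↦ (−1)^j·v(x) is strictly decreasing on [−c_{2j+2}, −c_{2j}]. -/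
open Real Set

theorem pos_of_ne_zero_of_isPreconnected {f : ℝ → ℝ} {s : Set ℝ} (hs : IsPreconnected s)
    (hf : ContinuousOn f s) (hne : ∀ x ∈ s, f x ≠ 0) {y : ℝ} (hy : y ∈ s) (hfy : 0 < f y) :
    ∀ x ∈ s, 0 < f x := by
  intro x hx
  by_contra! hneg
  obtain ⟨z, hz, hfz⟩ := hs.intermediate_value hx hy hf ⟨hneg, hfy.le⟩
  exact hne z hz hfz

/-- A differentiable function changes sign at a simple zero. -/
theorem neg_left_of_pos_right_of_simple_zero {f f' : ℝ → ℝ} (hf : ∀ x, HasDerivAt f (f' x) x)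
    {a m b : ℝ} (hmb : m < b) (hm : f m = 0) (hm' : f' m ≠ 0)
    (hpos : ∀ x ∈ Ioo m b, 0 < f x) (hne : ∀ x ∈ Ioo a m, f x ≠ 0) :
    ∀ x ∈ Ioo a m, f x < 0 := by
  intro x hx
  by_contra! hx0
  have hleft := pos_of_ne_zero_of_isPreconnected isPreconnected_Ioo
    (fun y _ => (hf y).continuousAt.continuousWithinAt) hne hx
    (lt_of_le_of_ne hx0 (hne x hx).symm)
  have hmin : IsLocalMin f m := by
    filter_upwards [Ioo_mem_nhds (hx.1.trans hx.2) hmb] with y hy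
    rw [hm]
    rcases lt_trichotomy y m with h | h | h
    · exact (hleft y ⟨hy.1, h⟩).le
    · rw [h, hm]
    · exact (hpos y ⟨h, hy.2⟩).le
  exact hm' (hmin.hasDerivAt_eq_zero (hf m))

/-- Signs of a function between consecutive simple zeros accumulating only at `-∞`. -/
theorem sign_alternates_of_simple_zeros {f f' : ℝ → ℝ} (hf : ∀ x, HasDerivAt f (f' x) x)
    {z : ℕ → ℝ} (hz : StrictMono z) {b : ℝ} (hb : -z 0 < b)
    (hzero : ∀ x < b, f x = 0 ↔ ∃ j, x = -z j)
    (hsimple : ∀ j, f' (-z j) ≠ 0) (hpos : ∀ x ∈ Ioo (-z 0) b, 0 < f x) (j : ℕ) :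
    ∀ x ∈ Ioo (-z (j + 1)) (-z j), (-1 : ℝ) ^ j * f x < 0 := by
  have hlt (k : ℕ) : -z k < b := by
    have := hz.monotone (Nat.zero_le k)
    linarith
  have hzk (k : ℕ) : f (-z k) = 0 := (hzero _ (hlt k)).2 ⟨k, rfl⟩
  have hne (k : ℕ) : ∀ x ∈ Ioo (-z (k + 1)) (-z k), f x ≠ 0 := by
    intro x hx h0
    obtain ⟨i, rfl⟩ := (hzero x (hx.2.trans (hlt k))).1 h0
    have h1 := hz.lt_iff_lt.1 (neg_lt_neg_iff.1 hx.1)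
    have h2 := hz.lt_iff_lt.1 (neg_lt_neg_iff.1 hx.2)
    omega
  induction j with
  | zero =>
    simpa using neg_left_of_pos_right_of_simple_zero hf hb (hzk 0) (hsimple 0) hpos (hne 0)
  | succ k ih =>
    refine neg_left_of_pos_right_of_simple_zero
      (f := fun x => (-1 : ℝ) ^ (k + 1) * f x) (f' := fun x => (-1 : ℝ) ^ (k + 1) * f' x)
      (fun x => (hf x).const_mul _) (neg_lt_neg (hz (Nat.lt_succ_self k))) ?_ ?_ ?_ ?_
    · simp [hzk]
    · simpa using hsimple (k + 1)
    · intro x hx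
      have := ih x hx
      rw [pow_succ]
      linarith
    · intro x hx
      simpa using hne (k + 1) x hx

theorem strictMonoOn_of_hasDerivAt_pos {f f' : ℝ → ℝ} (hf : ∀ x, HasDerivAt f (f' x) x)
    {s : Set ℝ} (hs : Convex ℝ s) (hpos : ∀ x ∈ interior s, 0 < f' x) : StrictMonoOn f s :=
  strictMonoOn_of_deriv_pos hs (fun x _ => (hf x).continuousAt.continuousWithinAt)
    fun x hx => by rw [(hf x).deriv]; exact hpos x hx

theorem strictAntiOn_of_hasDerivAt_neg {f f' : ℝ → ℝ} (hf : ∀ x, HasDerivAt f (f' x) x)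
    {s : Set ℝ} (hs : Convex ℝ s) (hneg : ∀ x ∈ interior s, f' x < 0) : StrictAntiOn f s :=
  strictAntiOn_of_deriv_neg hs (fun x _ => (hf x).continuousAt.continuousWithinAt)
    fun x hx => by rw [(hf x).deriv]; exact hneg x hx

theorem stmt_1 (u v u' v' : ℝ → ℝ)
    (hu : ∀ x, HasDerivAt u (u' x) x)
    (huAiry : ∀ x, HasDerivAt u' (x * u x) x)
    (hv : ∀ x, HasDerivAt v (v' x) x)
    (hvAiry : ∀ x, HasDerivAt v' (x * v x) x)
    (hu0 : u 0 = 1) (hu'0 : u' 0 = 0) (hv0 : v 0 = 0) (hv'0 : v' 0 = 1)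
    (c ct : ℕ → ℝ)
    (hcpos : ∀ p, 0 < c p) (hctpos : ∀ p, 0 < ct p)
    (hc_even_mono : StrictMono (fun j => c (2*j)))
    (hc_odd_mono : StrictMono (fun j => c (2*j+1)))
    (hct_even_mono : StrictMono (fun j => ct (2*j)))
    (hct_odd_mono : StrictMono (fun j => ct (2*j+1)))
    (hzv' : ∀ x : ℝ, v' x = 0 ↔ ∃ j : ℕ, x = -c (2*j))
    (hzv : ∀ x : ℝ, x < 0 → (v x = 0 ↔ ∃ j : ℕ, x = -c (2*j+1)))
    (hzu : ∀ x : ℝ, u x = 0 ↔ ∃ j : ℕ, x = -ct (2*j))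
    (hzu' : ∀ x : ℝ, x < 0 → (u' x = 0 ↔ ∃ j : ℕ, x = -ct (2*j+1))) :
    -- (i) u > 0 on (-c̃₀, +∞)
    (∀ x : ℝ, -ct 0 < x → 0 < u x) ∧
    -- (ii) (-1)^j u < 0 on (-c̃_{2j+2}, -c̃_{2j})
    (∀ j : ℕ, ∀ x ∈ Ioo (-ct (2*j+2)) (-ct (2*j)), (-1:ℝ)^j * u x < 0) ∧
    -- (iii) u strictly increasing on (-c̃₁, +∞)
    StrictMonoOn u (Ioi (-ct 1)) ∧
    -- (iv) (-1)^j u strictly decreasing on [-c̃_{2j+3}, -c̃_{2j+1}]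
    (∀ j : ℕ, StrictAntiOn (fun x => (-1:ℝ)^j * u x) (Icc (-ct (2*j+3)) (-ct (2*j+1)))) ∧
    -- (v) v > 0 on (0, +∞), v < 0 on (-c₁, 0)
    (∀ x : ℝ, 0 < x → 0 < v x) ∧
    (∀ x ∈ Ioo (-c 1) (0:ℝ), v x < 0) ∧
    -- (vi) (-1)^j v > 0 on (-c_{2j+3}, -c_{2j+1})
    (∀ j : ℕ, ∀ x ∈ Ioo (-c (2*j+3)) (-c (2*j+1)), 0 < (-1:ℝ)^j * v x) ∧
    -- (vii) v strictly increasing on (-c₀, +∞)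
    StrictMonoOn v (Ioi (-c 0)) ∧
    -- (viii) (-1)^j v strictly decreasing on [-c_{2j+2}, -c_{2j}]
    (∀ j : ℕ, StrictAntiOn (fun x => (-1:ℝ)^j * v x) (Icc (-c (2*j+2)) (-c (2*j)))) := by
  have hW (x : ℝ) : u x * v' x - u' x * v x = 1 := by
    have hd (y : ℝ) : HasDerivAt (fun t => u t * v' t - u' t * v t) 0 y := by
      refine (((hu y).mul (hvAiry y)).sub ((huAiry y).mul (hv y))).congr_deriv ?_
      ring
    have := is_const_of_deriv_eq_zero (fun y => (hd y).differentiableAt)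
      (fun y => (hd y).deriv) x 0
    simpa [hu0, hv'0, hv0, hu'0] using this
  have hu_simple (x : ℝ) (h : u x = 0) : u' x ≠ 0 := by
    intro h'
    simpa [h, h'] using hW x
  have hv_simple (x : ℝ) (h : v x = 0) : v' x ≠ 0 := by
    intro h'
    simpa [h, h'] using hW x
  have hu_pos : ∀ x ∈ Ioi (-ct 0), 0 < u x := by
    refine pos_of_ne_zero_of_isPreconnected isPreconnected_Ioi
      (fun y _ => (hu y).continuousAt.continuousWithinAt) ?_
      (show (0 : ℝ) ∈ Ioi (-ct 0) from neg_neg_of_pos (hctpos 0)) (by rw [hu0]; exact one_pos)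
    intro x hx h0
    obtain ⟨j, rfl⟩ := (hzu x).1 h0
    have h1 : ct (2 * 0) ≤ ct (2 * j) := hct_even_mono.monotone (Nat.zero_le j)
    have h2 : -ct 0 < -ct (2 * j) := hx
    rw [mul_zero] at h1
    linarith
  have hv'_pos : ∀ x ∈ Ioi (-c 0), 0 < v' x := by
    refine pos_of_ne_zero_of_isPreconnected isPreconnected_Ioi
      (fun y _ => (hvAiry y).continuousAt.continuousWithinAt) ?_
      (show (0 : ℝ) ∈ Ioi (-c 0) from neg_neg_of_pos (hcpos 0)) (by rw [hv'0]; exact one_pos)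
    intro x hx h0
    obtain ⟨j, rfl⟩ := (hzv' x).1 h0
    have h1 : c (2 * 0) ≤ c (2 * j) := hc_even_mono.monotone (Nat.zero_le j)
    have h2 : -c 0 < -c (2 * j) := hx
    rw [mul_zero] at h1
    linarith
  have hu'_pos_right (x : ℝ) (hx : 0 < x) : 0 < u' x := by
    have hmono : StrictMonoOn u' (Ici 0) := by
      refine strictMonoOn_of_hasDerivAt_pos huAiry (convex_Ici 0) fun y hy => ?_
      rw [interior_Ici, mem_Ioi] at hy
      exact mul_pos hy (hu_pos y ((neg_neg_of_pos (hctpos 0)).trans hy))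
    simpa [hu'0] using hmono self_mem_Ici hx.le hx
  have hu'_pos_near (x : ℝ) (hx : x ∈ Ioo (-ct 0) 0) : 0 < u' x := by
    have hanti : StrictAntiOn u' (Icc (-ct 0) 0) := by
      refine strictAntiOn_of_hasDerivAt_neg huAiry (convex_Icc _ _) fun y hy => ?_
      rw [interior_Icc] at hy
      exact mul_neg_of_neg_of_pos hy.2 (hu_pos y hy.1)
    simpa [hu'0] using hanti ⟨hx.1.le, hx.2.le⟩ ⟨(hx.1.trans hx.2).le, le_rfl⟩ hx.2
  have hu'_pos : ∀ x ∈ Ioo (-ct 1) 0, 0 < u' x := by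
    obtain ⟨y, hy, hy0⟩ := exists_between
      (max_lt (neg_neg_of_pos (hctpos 0)) (neg_neg_of_pos (hctpos 1)))
    rw [max_lt_iff] at hy
    refine pos_of_ne_zero_of_isPreconnected isPreconnected_Ioo
      (fun y _ => (huAiry y).continuousAt.continuousWithinAt) ?_
      (show y ∈ Ioo (-ct 1) 0 from ⟨hy.2, hy0⟩) (hu'_pos_near y ⟨hy.1, hy0⟩)
    intro x hx h0
    obtain ⟨j, rfl⟩ := (hzu' x hx.2).1 h0
    have h1 : ct (2 * 0 + 1) ≤ ct (2 * j + 1) := hct_odd_mono.monotone (Nat.zero_le j)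
    have h2 := hx.1
    rw [mul_zero, zero_add] at h1
    linarith
  have hv_mono : StrictMonoOn v (Ioi (-c 0)) :=
    strictMonoOn_of_hasDerivAt_pos hv (convex_Ioi _) (by rwa [interior_Ioi])
  have h0c : (0 : ℝ) ∈ Ioi (-c 0) := neg_neg_of_pos (hcpos 0)
  have hv_pos (x : ℝ) (hx : 0 < x) : 0 < v x := by
    simpa [hv0] using hv_mono h0c (lt_trans h0c hx) hx
  have hv_neg : ∀ x ∈ Ioo (-c 1) (0 : ℝ), v x < 0 := by
    refine neg_left_of_pos_right_of_simple_zero hv one_pos hv0 (hv_simple 0 hv0)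
      (fun x hx => hv_pos x hx.1) ?_
    intro x hx h0
    obtain ⟨j, rfl⟩ := (hzv x hx.2).1 h0
    have h1 : c (2 * 0 + 1) ≤ c (2 * j + 1) := hc_odd_mono.monotone (Nat.zero_le j)
    have h2 := hx.1
    rw [mul_zero, zero_add] at h1
    linarith
  refine ⟨hu_pos, ?_, ?_, ?_, hv_pos, hv_neg, ?_, hv_mono, ?_⟩
  · exact sign_alternates_of_simple_zeros hu hct_even_mono
      (neg_neg_of_pos (hctpos 0)) (fun x _ => hzu x)
      (fun j => hu_simple _ ((hzu _).2 ⟨j, rfl⟩)) (fun x hx => hu_pos x hx.1)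
  · have hleft : StrictMonoOn u (Ioc (-ct 1) 0) :=
      strictMonoOn_of_hasDerivAt_pos hu (convex_Ioc _ _) (by rwa [interior_Ioc])
    have hright : StrictMonoOn u (Ici 0) :=
      strictMonoOn_of_hasDerivAt_pos hu (convex_Ici _) (by rwa [interior_Ici])
    have h := hleft.union hright (isGreatest_Ioc (neg_neg_of_pos (hctpos 1))) isLeast_Ici
    rwa [Ioc_union_Ici_eq_Ioi (neg_neg_of_pos (hctpos 1))] at h
  · intro j
    refine strictAntiOn_of_hasDerivAt_neg (fun x => (hu x).const_mul _) (convex_Icc _ _) ?_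
    rw [interior_Icc]
    refine sign_alternates_of_simple_zeros huAiry hct_odd_mono
      (neg_neg_of_pos (hctpos 1)) hzu' (fun k => ?_) hu'_pos j
    have hk : -ct (2 * k + 1) < 0 := neg_neg_of_pos (hctpos _)
    exact mul_ne_zero hk.ne fun h => hu_simple _ h ((hzu' _ hk).2 ⟨k, rfl⟩)
  · intro j x hx
    have h := sign_alternates_of_simple_zeros (f := fun x => -v x) (fun x => (hv x).neg)
      hc_odd_mono (neg_neg_of_pos (hcpos 1)) (fun x hx => neg_eq_zero.trans (hzv x hx))
      (fun k => neg_ne_zero.2 (hv_simple _ ((hzv _ (neg_neg_of_pos (hcpos _))).2 ⟨k, rfl⟩)))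
      (fun x hx => neg_pos.2 (hv_neg x hx)) j x hx
    linarith
  · intro j
    refine strictAntiOn_of_hasDerivAt_neg (fun x => (hv x).const_mul _) (convex_Icc _ _) ?_
    rw [interior_Icc]
    refine sign_alternates_of_simple_zeros hvAiry hc_even_mono
      (neg_neg_of_pos (hcpos 0)) (fun x _ => hzv' x) (fun k => ?_)
      (fun x hx => hv'_pos x hx.1) j
    have hk : -c (2 * k) < 0 := neg_neg_of_pos (hcpos _)
    exact mul_ne_zero hk.ne fun h => hv_simple _ h ((hzv' _).2 ⟨k, rfl⟩)
end

section
/- The zeros of the canonical solutions and of their derivatives are interlaced as follows: for every j ≥ 0, c_{2j} < c̃_{2j} (the j-th zero of u lies strictly to the left of the j-th zero of v') and c_{2j+1} < c̃_{2j+1} (the j-th negative zero of u' lies strictly to the left of the j-th negative zero of v); equivalently, −c̃_p < −c_p for every p ≥ 0. -/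
open Real Set

/-- A pair of solutions of the reflected Airy equation `y'' = -t y`, with derivatives `U'`, `V'`,
normalised like cosine and sine at the origin. -/
structure IsAiryPair (U U' V V' : ℝ → ℝ) : Prop where
  hasDerivAt_cos : ∀ t, HasDerivAt U (U' t) t
  hasDerivAt_cos' : ∀ t, HasDerivAt U' (-(t * U t)) t
  hasDerivAt_sin : ∀ t, HasDerivAt V (V' t) t
  hasDerivAt_sin' : ∀ t, HasDerivAt V' (-(t * V t)) t
  cos_zero : U 0 = 1
  cos'_zero : U' 0 = 0
  sin_zero : V 0 = 0
  sin'_zero : V' 0 = 1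

namespace IsAiryPair

variable {U U' V V' : ℝ → ℝ}

theorem wronskian (h : IsAiryPair U U' V V') (t : ℝ) : U t * V' t - U' t * V t = 1 := by
  have hd : ∀ s, HasDerivAt (fun s => U s * V' s - U' s * V s) 0 s := fun s => by
    refine (((h.hasDerivAt_cos s).mul (h.hasDerivAt_sin' s)).sub
      ((h.hasDerivAt_cos' s).mul (h.hasDerivAt_sin s))).congr_deriv ?_
    ring
  have := is_const_of_deriv_eq_zero (fun s => (hd s).differentiableAt) (fun s => (hd s).deriv) t 0
  simpa [h.cos_zero, h.cos'_zero, h.sin_zero, h.sin'_zero] using this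

theorem hasDerivAt_mul (h : IsAiryPair U U' V V') (t : ℝ) :
    HasDerivAt (fun s => U s * V s) (U t * V' t + U' t * V t) t :=
  ((h.hasDerivAt_cos t).mul (h.hasDerivAt_sin t)).congr_deriv (by ring)

theorem hasDerivAt_deriv_mul (h : IsAiryPair U U' V V') (t : ℝ) :
    HasDerivAt (fun s => U s * V' s + U' s * V s) (2 * (U' t * V' t) - 2 * t * (U t * V t)) t :=
  (((h.hasDerivAt_cos t).mul (h.hasDerivAt_sin' t)).add
    ((h.hasDerivAt_cos' t).mul (h.hasDerivAt_sin t))).congr_deriv (by ring)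

theorem hasDerivAt_cross (h : IsAiryPair U U' V V') (t : ℝ) :
    HasDerivAt (fun s => s * (U s * V s) + U' s * V' s) (U t * V t) t :=
  (((hasDerivAt_id t).mul (h.hasDerivAt_mul t)).add
    ((h.hasDerivAt_cos' t).mul (h.hasDerivAt_sin' t))).congr_deriv (by simp only [id]; ring)

theorem cross_ne_zero (h : IsAiryPair U U' V V') {t : ℝ} (ht : 0 < t) :
    t * (U t * V t) + U' t * V' t ≠ 0 := by
  intro h0
  set W : ℝ → ℝ := fun s => s * (U s * V s) + U' s * V' s with hW
  set E : ℝ → ℝ := fun s =>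
    W s * (U s * V' s + U' s * V s) - (U s * V s) ^ 2 / 2 + 2 * s * W s ^ 2 with hE
  have hEd : ∀ s, HasDerivAt E (4 * W s ^ 2) s := fun s => by
    refine ((((h.hasDerivAt_cross s).mul (h.hasDerivAt_deriv_mul s)).sub
      (((h.hasDerivAt_mul s).pow 2).div_const 2)).add
      (((hasDerivAt_id s).const_mul 2).mul ((h.hasDerivAt_cross s).pow 2))).congr_deriv ?_
    simp only [hW, id, Pi.pow_apply]
    push_cast
    ring
  have hmono : Monotone E := monotone_of_deriv_nonneg (fun s => (hEd s).differentiableAt)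
    fun s => by rw [(hEd s).deriv]; positivity
  have hE0 : E 0 = 0 := by simp [hE, hW, h.cos'_zero, h.sin_zero]
  have hEt : E t ≤ 0 := by
    have : W t = 0 := h0
    simp only [hE, this]
    nlinarith [sq_nonneg (U t * V t)]
  have hEz : ∀ s ∈ Ioo 0 t, E s = 0 := fun s hs =>
    le_antisymm ((hmono hs.2.le).trans hEt) (hE0 ▸ hmono hs.1.le)
  have hzero : ∀ {f : ℝ → ℝ} {f' : ℝ → ℝ}, (∀ s, HasDerivAt f (f' s) s) →
      (∀ s ∈ Ioo 0 t, f s = 0) → ∀ s ∈ Ioo 0 t, f' s = 0 := fun {f f'} hf hz s hs => by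
    have : f =ᶠ[nhds s] fun _ => 0 := Filter.mem_of_superset (Ioo_mem_nhds hs.1 hs.2) hz
    exact (hf s).unique ((hasDerivAt_const s 0).congr_of_eventuallyEq this)
  have hWz : ∀ s ∈ Ioo 0 t, W s = 0 := fun s hs => by
    simpa using hzero hEd hEz s hs
  have hWz' := hzero h.hasDerivAt_cross hWz
  have hWz'' := hzero h.hasDerivAt_mul hWz'
  have hs : t / 2 ∈ Ioo 0 t := ⟨by linarith, by linarith⟩
  have h1 := hWz' _ hs
  have h2 := hWz'' _ hs
  have h3 := h.wronskian (t / 2)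
  rcases mul_eq_zero.1 h1 with h1 | h1 <;> simp only [h1, zero_mul, mul_zero] at h2 h3 <;> linarith

theorem cross_pos (h : IsAiryPair U U' V V') {t : ℝ} (ht : 0 < t) :
    0 < t * (U t * V t) + U' t * V' t := by
  have hcont : Continuous fun s => s * (U s * V s) + U' s * V' s :=
    continuous_iff_continuousAt.2 fun s => (h.hasDerivAt_cross s).continuousAt
  have hcont₁ : Continuous fun s => U s * V s :=
    continuous_iff_continuousAt.2 fun s => (h.hasDerivAt_mul s).continuousAt
  have hev : ∀ᶠ s in nhds (0 : ℝ), 0 < U s * V' s + U' s * V s :=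
    (h.hasDerivAt_deriv_mul 0).continuousAt.eventually
      (lt_mem_nhds (by simp [h.cos_zero, h.sin'_zero, h.sin_zero]))
  obtain ⟨δ, hδ, hpos⟩ := Metric.eventually_nhds_iff.1 hev
  obtain ⟨r, hr0, hrδ⟩ := exists_between hδ
  have hmul : ∀ s ∈ Ioc 0 r, 0 < U s * V s := fun s hs => by
    have hm : StrictMonoOn (fun s => U s * V s) (Icc 0 r) :=
      strictMonoOn_of_deriv_pos (convex_Icc 0 r) hcont₁.continuousOn fun y hy => by
        rw [interior_Icc] at hy
        rw [(h.hasDerivAt_mul y).deriv]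
        exact hpos (by rw [Real.dist_eq, sub_zero, abs_of_pos hy.1]; exact hy.2.trans hrδ)
    simpa [h.sin_zero] using hm (left_mem_Icc.2 hr0.le) (Ioc_subset_Icc_self hs) hs.1
  have hWr : 0 < r * (U r * V r) + U' r * V' r := by
    have hm : StrictMonoOn (fun s => s * (U s * V s) + U' s * V' s) (Icc 0 r) :=
      strictMonoOn_of_deriv_pos (convex_Icc 0 r) hcont.continuousOn fun y hy => by
        rw [interior_Icc] at hy
        rw [(h.hasDerivAt_cross y).deriv]
        exact hmul y (Ioo_subset_Ioc_self hy)
    simpa [h.cos'_zero] using hm (left_mem_Icc.2 hr0.le) (right_mem_Icc.2 hr0.le) hr0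
  by_contra! hle
  obtain ⟨s, hs, hs0⟩ := isPreconnected_Ioi.intermediate_value (mem_Ioi.2 ht) (mem_Ioi.2 hr0)
    hcont.continuousOn ⟨hle, hWr.le⟩
  exact h.cross_ne_zero hs hs0

theorem exists_sin'_eq_zero (h : IsAiryPair U U' V V') {a b : ℝ} (ha : 0 ≤ a) (hab : a < b)
    (hUa : a = 0 ∨ U a = 0) (hUb : U b = 0) : ∃ t ∈ Ioo a b, V' t = 0 := by
  by_contra! hne
  have hne' : ∀ t, 0 < t → U t = 0 → V' t ≠ 0 := fun t ht hU hV => by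
    simpa [hU, hV] using h.cross_pos ht
  have hne_a : V' a ≠ 0 := by
    rcases ha.eq_or_lt with rfl | ha'
    · simp [h.sin'_zero]
    · exact hne' a ha' (hUa.resolve_left ha'.ne')
  have hneI : ∀ t ∈ Icc a b, V' t ≠ 0 := fun t ht => by
    rcases ht.1.eq_or_lt with rfl | h1
    · exact hne_a
    rcases ht.2.eq_or_lt with rfl | h2
    · exact hne' _ (ha.trans_lt hab) hUb
    exact hne t ⟨h1, h2⟩
  have hd := fun t (ht : t ∈ Icc a b) =>
    (h.hasDerivAt_cos t).div (h.hasDerivAt_sin' t) (hneI t ht)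
  have hm : StrictMonoOn (U / V') (Icc a b) :=
    strictMonoOn_of_deriv_pos (convex_Icc a b)
      (fun t ht => (hd t ht).continuousAt.continuousWithinAt) fun t ht => by
        rw [interior_Icc] at ht
        have ht' := Ioo_subset_Icc_self ht
        rw [(hd t ht').deriv]
        have := hneI t ht'
        have := h.cross_pos (ha.trans_lt ht.1)
        refine div_pos ?_ (by positivity)
        linarith
  have hlt := hm (left_mem_Icc.2 hab.le) (right_mem_Icc.2 hab.le) hab
  rcases hUa with rfl | hUa
  · norm_num [hUb, h.cos_zero, h.sin'_zero] at hlt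
  · simp [hUa, hUb] at hlt

theorem strictAntiOn_cos'_div_sin (h : IsAiryPair U U' V V') {s : Set ℝ} (hs : Convex ℝ s)
    (hpos : ∀ t ∈ s, 0 < t) (hne : ∀ t ∈ s, V t ≠ 0) : StrictAntiOn (U' / V) s := by
  have hd := fun t (ht : t ∈ s) => (h.hasDerivAt_cos' t).div (h.hasDerivAt_sin t) (hne t ht)
  refine strictAntiOn_of_deriv_neg hs
    (fun t ht => (hd t ht).continuousAt.continuousWithinAt) fun t ht => ?_
  have ht' := interior_subset ht
  rw [(hd t ht').deriv]
  have := hne t ht'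
  have := h.cross_pos (hpos t ht')
  refine div_neg_of_neg_of_pos ?_ (by positivity)
  linarith

theorem sin_ne_zero_of_cos'_eq_zero (h : IsAiryPair U U' V V') {t : ℝ} (ht : 0 < t)
    (hU : U' t = 0) : V t ≠ 0 := fun hV => by
  simpa [hU, hV] using h.cross_pos ht

theorem exists_sin_eq_zero (h : IsAiryPair U U' V V') {a b : ℝ} (ha : 0 < a) (hab : a < b)
    (hUa : U' a = 0) (hUb : U' b = 0) : ∃ t ∈ Ioo a b, V t = 0 := by
  by_contra! hne
  have hneI : ∀ t ∈ Icc a b, V t ≠ 0 := fun t ht => by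
    rcases ht.1.eq_or_lt with rfl | h1
    · exact h.sin_ne_zero_of_cos'_eq_zero ha hUa
    rcases ht.2.eq_or_lt with rfl | h2
    · exact h.sin_ne_zero_of_cos'_eq_zero (ha.trans hab) hUb
    exact hne t ⟨h1, h2⟩
  have hlt := h.strictAntiOn_cos'_div_sin (convex_Icc a b) (fun t ht => ha.trans_le ht.1) hneI
    (left_mem_Icc.2 hab.le) (right_mem_Icc.2 hab.le) hab
  simp [hUa, hUb] at hlt

theorem exists_sin_eq_zero_of_cos'_eq_zero (h : IsAiryPair U U' V V') {b : ℝ} (hb : 0 < b)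
    (hUb : U' b = 0) : ∃ t ∈ Ioo 0 b, V t = 0 := by
  by_contra! hne
  have hneI : ∀ t ∈ Ioc 0 b, V t ≠ 0 := fun t ht => by
    rcases ht.2.eq_or_lt with rfl | h2
    · exact h.sin_ne_zero_of_cos'_eq_zero hb hUb
    exact hne t ⟨ht.1, h2⟩
  have hne_cos : ∀ t ∈ Ico 0 b, U t ≠ 0 := fun t ht hU => by
    rcases ht.1.eq_or_lt with rfl | h1
    · simp [h.cos_zero] at hU
    have hlt := h.strictAntiOn_cos'_div_sin (convex_Ioc 0 b) (fun t ht => ht.1) hneI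
      ⟨h1, ht.2.le⟩ (right_mem_Ioc.2 hb) ht.2
    have hw := h.wronskian t
    simp only [Pi.div_apply, hUb, zero_div] at hlt
    rw [hU, zero_mul] at hw
    rcases div_pos_iff.1 hlt with ⟨h2, h3⟩ | ⟨h2, h3⟩
    · linarith [mul_pos h2 h3]
    · linarith [mul_pos_of_neg_of_neg h2 h3]
  have hU : Continuous U := continuous_iff_continuousAt.2 fun t => (h.hasDerivAt_cos t).continuousAt
  have hU' : Continuous U' :=
    continuous_iff_continuousAt.2 fun t => (h.hasDerivAt_cos' t).continuousAt
  have hcos : ∀ t ∈ Ico 0 b, 0 < U t := fun t ht => by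
    by_contra! hle
    obtain ⟨s, hs, hs0⟩ := isPreconnected_Ico.intermediate_value ht (left_mem_Ico.2 hb)
      hU.continuousOn ⟨hle, by simp [h.cos_zero]⟩
    exact hne_cos s hs hs0
  have hanti : StrictAntiOn U' (Icc 0 b) :=
    strictAntiOn_of_deriv_neg (convex_Icc 0 b) hU'.continuousOn fun t ht => by
      rw [interior_Icc] at ht
      rw [(h.hasDerivAt_cos' t).deriv]
      exact neg_neg_of_pos (mul_pos ht.1 (hcos t (Ioo_subset_Ico_self ht)))
  have := hanti (left_mem_Icc.2 hb.le) (right_mem_Icc.2 hb.le) hb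
  simp [hUb, h.cos'_zero] at this

end IsAiryPair

theorem StrictMono.lt_of_exists_between {a b : ℕ → ℝ} (ha : StrictMono a)
    (h0 : ∃ k, a k < b 0) (h : ∀ j, ∃ k, b j ≤ a k ∧ a k < b (j + 1)) (j : ℕ) : a j < b j := by
  suffices H : ∃ k, j ≤ k ∧ a k < b j by
    obtain ⟨k, hjk, hk⟩ := H
    exact (ha.monotone hjk).trans_lt hk
  induction j with
  | zero => exact h0.imp fun k hk => ⟨k.zero_le, hk⟩
  | succ j ih =>
    obtain ⟨k, hjk, hk⟩ := ih
    obtain ⟨l, hl, hl'⟩ := h j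
    exact ⟨l, hjk.trans_lt (ha.lt_iff_lt.1 (hk.trans_le hl)), hl'⟩

theorem stmt_2 (u v u' v' : ℝ → ℝ)
    (hu : ∀ x, HasDerivAt u (u' x) x)
    (huAiry : ∀ x, HasDerivAt u' (x * u x) x)
    (hv : ∀ x, HasDerivAt v (v' x) x)
    (hvAiry : ∀ x, HasDerivAt v' (x * v x) x)
    (hu0 : u 0 = 1) (hu'0 : u' 0 = 0) (hv0 : v 0 = 0) (hv'0 : v' 0 = 1)
    (c ct : ℕ → ℝ)
    (hcpos : ∀ p, 0 < c p) (hctpos : ∀ p, 0 < ct p)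
    (hc_even_mono : StrictMono (fun j => c (2*j)))
    (hc_odd_mono : StrictMono (fun j => c (2*j+1)))
    (hct_even_mono : StrictMono (fun j => ct (2*j)))
    (hct_odd_mono : StrictMono (fun j => ct (2*j+1)))
    (hzv' : ∀ x : ℝ, v' x = 0 ↔ ∃ j : ℕ, x = -c (2*j))
    (hzv : ∀ x : ℝ, x < 0 → (v x = 0 ↔ ∃ j : ℕ, x = -c (2*j+1)))
    (hzu : ∀ x : ℝ, u x = 0 ↔ ∃ j : ℕ, x = -ct (2*j))
    (hzu' : ∀ x : ℝ, x < 0 → (u' x = 0 ↔ ∃ j : ℕ, x = -ct (2*j+1))) :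
    ∀ p : ℕ, c p < ct p := by
  have h : IsAiryPair (fun t => u (-t)) (fun t => -u' (-t)) (fun t => -v (-t))
      (fun t => v' (-t)) :=
    { hasDerivAt_cos := fun t =>
        ((hu (-t)).comp t (hasDerivAt_neg t)).congr_deriv (by ring)
      hasDerivAt_cos' := fun t =>
        ((huAiry (-t)).comp t (hasDerivAt_neg t)).neg.congr_deriv (by ring)
      hasDerivAt_sin := fun t =>
        ((hv (-t)).comp t (hasDerivAt_neg t)).neg.congr_deriv (by ring)
      hasDerivAt_sin' := fun t =>
        ((hvAiry (-t)).comp t (hasDerivAt_neg t)).congr_deriv (by ring)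
      cos_zero := by simpa using hu0
      cos'_zero := by simpa using hu'0
      sin_zero := by simpa using hv0
      sin'_zero := by simpa using hv'0 }
  have hu_ct : ∀ j, u (-ct (2 * j)) = 0 := fun j => (hzu _).2 ⟨j, rfl⟩
  have hu'_ct : ∀ j, -u' (-ct (2 * j + 1)) = 0 := fun j =>
    neg_eq_zero.2 ((hzu' _ (neg_neg_of_pos (hctpos _))).2 ⟨j, rfl⟩)
  have hv'_c : ∀ t, v' (-t) = 0 → ∃ k, t = c (2 * k) := fun t ht =>
    ((hzv' _).1 ht).imp fun _ => neg_inj.1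
  have hv_c : ∀ t, 0 < t → -v (-t) = 0 → ∃ k, t = c (2 * k + 1) := fun t ht htv =>
    ((hzv _ (neg_neg_of_pos ht)).1 (neg_eq_zero.1 htv)).imp fun _ => neg_inj.1
  intro p
  obtain ⟨j, rfl | rfl⟩ := p.even_or_odd'
  · refine hc_even_mono.lt_of_exists_between (b := fun j => ct (2 * j)) ?_ (fun i => ?_) j
    · obtain ⟨t, ht, htz⟩ := h.exists_sin'_eq_zero le_rfl (hctpos _) (.inl rfl) (hu_ct 0)
      obtain ⟨k, rfl⟩ := hv'_c t htz
      exact ⟨k, ht.2⟩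
    · obtain ⟨t, ht, htz⟩ := h.exists_sin'_eq_zero (hctpos _).le
        (hct_even_mono i.lt_succ_self) (.inr (hu_ct i)) (hu_ct (i + 1))
      obtain ⟨k, rfl⟩ := hv'_c t htz
      exact ⟨k, ht.1.le, ht.2⟩
  · refine hc_odd_mono.lt_of_exists_between (b := fun j => ct (2 * j + 1)) ?_ (fun i => ?_) j
    · obtain ⟨t, ht, htz⟩ := h.exists_sin_eq_zero_of_cos'_eq_zero (hctpos _) (hu'_ct 0)
      obtain ⟨k, rfl⟩ := hv_c t ht.1 htz
      exact ⟨k, ht.2⟩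
    · obtain ⟨t, ht, htz⟩ := h.exists_sin_eq_zero (hctpos _)
        (hct_odd_mono i.lt_succ_self) (hu'_ct i) (hu'_ct (i + 1))
      obtain ⟨k, rfl⟩ := hv_c t ((hctpos _).trans ht.1) htz
      exact ⟨k, ht.1.le, ht.2⟩
end

section
/- For every integer j ≥ 0 and every real x > 0: (1) if v'(−x) = 0 and x lies in (((3/2)(jπ+π/3))^(2/3), ((3/2)(jπ+π/2))^(2/3)), then (2/3)·x^(3/2) lies in the closed interval [5π/12 + jπ − 7/(12(jπ+π/3)), 5π/12 + jπ + 7/(12(jπ+π/3))]; (2) if v(−x) = 0 and x lies in (((3/2)(jπ+5π/6))^(2/3), ((3/2)(jπ+π))^(2/3)), then (2/3)·x^(3/2) lies in [11π/12 + jπ − 5/(36(jπ+5π/6)), 11π/12 + jπ + 5/(36(jπ+5π/6))]; (3) if u(−x) = 0 and x lies in (((3/2)(jπ+π/2))^(2/3), ((3/2)(jπ+2π/3))^(2/3)), then (2/3)·x^(3/2) lies in [7π/12 + jπ − 5/(36(jπ+π/2)), 7π/12 + jπ + 5/(36(jπ+π/2))]; (4) if u'(−x) = 0 and x lies in (((3/2)(jπ+π))^(2/3),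 ((3/2)(jπ+7π/6))^(2/3)), then (2/3)·x^(3/2) lies in [13π/12 + jπ − 7/(12(j+1)π), 13π/12 + jπ + 7/(12(j+1)π)]. -/
open Real Set

open MeasureTheory Filter Topology

/-- The function `1 + i s / 2`, along which the Hankel-type Laplace integrals are taken. -/
noncomputable def hankelLine (s : ℝ) : ℂ := 1 + ((s / 2 : ℝ) : ℂ) * Complex.I

/-- The integrand of `hankelMoment`. -/
noncomputable def hankelKernel (a b ζ s : ℝ) : ℂ :=
  ((s ^ b * exp (-(ζ * s)) : ℝ) : ℂ) * hankelLine s ^ (a : ℂ)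

/-- The Laplace integral `∫₀^∞ s ^ b * exp (-ζ s) * (1 + i s / 2) ^ a ds`. -/
noncomputable def hankelMoment (a b ζ : ℝ) : ℂ := ∫ s in Ioi 0, hankelKernel a b ζ s

lemma hankelLine_re (s : ℝ) : (hankelLine s).re = 1 := by simp [hankelLine]

lemma hankelLine_mem_slitPlane (s : ℝ) : hankelLine s ∈ Complex.slitPlane :=
  Or.inl (by simp [hankelLine_re])

lemma hankelLine_ne_zero (s : ℝ) : hankelLine s ≠ 0 :=
  Complex.slitPlane_ne_zero (hankelLine_mem_slitPlane s)

lemma one_le_norm_hankelLine (s : ℝ) : 1 ≤ ‖hankelLine s‖ := by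
  simpa [hankelLine_re] using Complex.re_le_norm (hankelLine s)

lemma norm_hankelLine_le {s : ℝ} (hs : 0 ≤ s) : ‖hankelLine s‖ ≤ 1 + s / 2 := by
  refine (norm_add_le _ _).trans ?_
  rw [norm_mul, Complex.norm_I, Complex.norm_real, norm_of_nonneg (by positivity)]
  simp

lemma hasDerivAt_hankelLine_cpow (a s : ℝ) :
    HasDerivAt (fun s => hankelLine s ^ (a : ℂ))
      (Complex.I / 2 * a * hankelLine s ^ ((a - 1 : ℝ) : ℂ)) s := by
  have h : HasDerivAt (fun z : ℂ => 1 + z / 2 * Complex.I) (1 / 2 * Complex.I) (s : ℂ) :=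
    (((hasDerivAt_id (s : ℂ)).div_const 2).mul_const _).const_add 1
  have h2 := (h.cpow_const (c := (a : ℂ)) (by
    have := hankelLine_mem_slitPlane s
    simpa [hankelLine] using this)).comp_ofReal
  have e : (fun s => hankelLine s ^ (a : ℂ)) =
      fun y : ℝ => (1 + (y : ℂ) / 2 * Complex.I) ^ (a : ℂ) := by
    funext y; simp [hankelLine]
  rw [e]
  convert h2 using 1
  simp only [hankelLine]
  push_cast
  ring

lemma norm_hankelLine_cpow_le {a s : ℝ} (ha : a ≤ 1) (hs : 0 ≤ s) :
    ‖hankelLine s ^ (a : ℂ)‖ ≤ 1 + s / 2 := by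
  rw [Complex.norm_cpow_real]
  calc ‖hankelLine s‖ ^ a ≤ ‖hankelLine s‖ ^ (1 : ℝ) :=
        rpow_le_rpow_of_exponent_le (one_le_norm_hankelLine s) ha
    _ ≤ 1 + s / 2 := by rw [rpow_one]; exact norm_hankelLine_le hs

lemma norm_hankelLine_cpow_sub_one_le {a s : ℝ} (ha : a ≤ 1) (hs : 0 ≤ s) :
    ‖hankelLine s ^ (a : ℂ) - 1‖ ≤ |a| / 2 * s := by
  have h := norm_image_sub_le_of_norm_deriv_le_segment' (a := 0) (b := s) (C := |a| / 2)
    (fun x _ => (hasDerivAt_hankelLine_cpow a x).hasDerivWithinAt) (fun x hx => by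
      rw [norm_mul, norm_mul, norm_div, Complex.norm_I, Complex.norm_real, Complex.norm_cpow_real]
      have : ‖hankelLine x‖ ^ (a - 1) ≤ 1 :=
        rpow_le_one_of_one_le_of_nonpos (one_le_norm_hankelLine x) (by linarith)
      calc 1 / ‖(2 : ℂ)‖ * ‖a‖ * ‖hankelLine x‖ ^ (a - 1) ≤ 1 / ‖(2 : ℂ)‖ * ‖a‖ * 1 := by gcongr
        _ = |a| / 2 := by simp; ring) s ⟨hs, le_rfl⟩
  simpa [hankelLine] using h

lemma integrableOn_rpow_mul_exp {b ζ : ℝ} (hb : -1 < b) (hζ : 0 < ζ) :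
    IntegrableOn (fun s => s ^ b * exp (-(ζ * s))) (Ioi 0) := by
  simpa using integrableOn_rpow_mul_exp_neg_mul_rpow hb one_pos hζ

/-- The Laplace transform of `s ↦ s ^ b`. -/
noncomputable def rpowLaplace (b ζ : ℝ) : ℝ := ∫ s in Ioi 0, s ^ b * exp (-(ζ * s))

lemma rpowLaplace_eq {b ζ : ℝ} (hb : -1 < b) (hζ : 0 < ζ) :
    rpowLaplace b ζ = (1 / ζ) ^ (b + 1) * Real.Gamma (b + 1) := by
  have := integral_rpow_mul_exp_neg_mul_Ioi (a := b + 1) (by linarith) hζ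
  simpa [rpowLaplace] using this

lemma rpowLaplace_pos {b ζ : ℝ} (hb : -1 < b) (hζ : 0 < ζ) : 0 < rpowLaplace b ζ := by
  rw [rpowLaplace_eq hb hζ]
  have := Real.Gamma_pos_of_pos (s := b + 1) (by linarith)
  positivity

lemma rpowLaplace_add_one {b ζ : ℝ} (hb : -1 < b) (hζ : 0 < ζ) :
    rpowLaplace (b + 1) ζ = (b + 1) / ζ * rpowLaplace b ζ := by
  rw [rpowLaplace_eq hb hζ, rpowLaplace_eq (by linarith) hζ,
    Real.Gamma_add_one (s := b + 1) (by linarith), rpow_add_one (x := 1 / ζ) (by positivity) (b + 1)]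
  ring

lemma continuous_hankelLine_cpow (a : ℝ) : Continuous fun s => hankelLine s ^ (a : ℂ) :=
  continuous_iff_continuousAt.2 fun s => (hasDerivAt_hankelLine_cpow a s).continuousAt

lemma measurable_hankelKernel (a b ζ : ℝ) : Measurable (hankelKernel a b ζ) := by
  have := (continuous_hankelLine_cpow a).measurable
  unfold hankelKernel
  fun_prop

lemma norm_hankelKernel_le {a b ζ s : ℝ} (ha : a ≤ 1) (hs : 0 < s) :
    ‖hankelKernel a b ζ s‖ ≤ s ^ b * exp (-(ζ * s)) + 1 / 2 * (s ^ (b + 1) * exp (-(ζ * s))) := by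
  rw [hankelKernel, norm_mul, Complex.norm_real, norm_of_nonneg (by positivity),
    rpow_add_one hs.ne']
  calc _ ≤ s ^ b * exp (-(ζ * s)) * (1 + s / 2) := by
        gcongr; exact norm_hankelLine_cpow_le ha hs.le
    _ = _ := by ring

lemma integrableOn_hankelKernel_bound {b ζ : ℝ} (hb : -1 < b) (hζ : 0 < ζ) :
    IntegrableOn (fun s => s ^ b * exp (-(ζ * s)) + 1 / 2 * (s ^ (b + 1) * exp (-(ζ * s))))
      (Ioi 0) :=
  (integrableOn_rpow_mul_exp hb hζ).add
    ((integrableOn_rpow_mul_exp (by linarith) hζ).const_mul _)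

lemma integrableOn_hankelKernel {a b ζ : ℝ} (ha : a ≤ 1) (hb : -1 < b) (hζ : 0 < ζ) :
    IntegrableOn (hankelKernel a b ζ) (Ioi 0) := by
  refine (integrableOn_hankelKernel_bound hb hζ).mono'
    (measurable_hankelKernel a b ζ).aestronglyMeasurable ?_
  filter_upwards [ae_restrict_mem measurableSet_Ioi] with s hs
  exact norm_hankelKernel_le ha hs

lemma hasDerivAt_hankelMoment {a b ζ : ℝ} (ha : a ≤ 1) (hb : -1 < b) (hζ : 0 < ζ) :
    HasDerivAt (hankelMoment a b) (-hankelMoment a (b + 1) ζ) ζ := by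
  have key := hasDerivAt_integral_of_dominated_loc_of_deriv_le (μ := volume.restrict (Ioi 0))
    (F := fun ζ s => hankelKernel a b ζ s) (F' := fun ζ s => -hankelKernel a (b + 1) ζ s)
    (x₀ := ζ) (Ioi_mem_nhds (half_lt_self hζ))
    (.of_forall fun z => (measurable_hankelKernel a b z).aestronglyMeasurable)
    (integrableOn_hankelKernel ha hb hζ)
    (measurable_hankelKernel a (b + 1) ζ).neg.aestronglyMeasurable
    (bound := fun s => s ^ (b + 1) * exp (-(ζ / 2 * s)) +
      1 / 2 * (s ^ (b + 1 + 1) * exp (-(ζ / 2 * s))))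
    ?_ (integrableOn_hankelKernel_bound (by linarith) (by linarith)) ?_
  · have := key.2
    rw [integral_neg] at this
    exact this
  · filter_upwards [ae_restrict_mem measurableSet_Ioi] with s hs z hz
    have hs' : (0 : ℝ) < s := hs
    have hz' : ζ / 2 < z := hz
    rw [norm_neg]
    refine (norm_hankelKernel_le ha hs).trans ?_
    gcongr
  · filter_upwards [ae_restrict_mem measurableSet_Ioi] with s hs z _
    have hs' : (0 : ℝ) < s := hs
    have h1 : HasDerivAt (fun z => s ^ b * exp (-(z * s)))
        (s ^ b * (exp (-(z * s)) * (-(1 * s)))) z :=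
      ((((hasDerivAt_id z).mul_const s).neg).exp).const_mul _
    have h2 := h1.ofReal_comp.mul_const (hankelLine s ^ (a : ℂ))
    refine h2.congr_deriv ?_
    rw [hankelKernel, rpow_add_one hs'.ne']
    push_cast
    ring

lemma hankelMoment_add_one_left {a b ζ : ℝ} (ha : a ≤ 0) (hb : -1 < b) (hζ : 0 < ζ) :
    hankelMoment (a + 1) b ζ =
      hankelMoment a b ζ + Complex.I / 2 * hankelMoment a (b + 1) ζ := by
  unfold hankelMoment
  rw [← integral_const_mul, ← integral_add (integrableOn_hankelKernel (by linarith) hb hζ)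
    ((integrableOn_hankelKernel (by linarith) (by linarith) hζ).const_mul _)]
  refine setIntegral_congr_fun measurableSet_Ioi fun s hs => ?_
  have hs' : (0 : ℝ) < s := hs
  simp only [hankelKernel]
  push_cast
  rw [Complex.cpow_add _ _ (hankelLine_ne_zero s), rpow_add_one hs'.ne', Complex.cpow_one]
  nth_rewrite 2 [hankelLine]
  push_cast
  ring

lemma hankelMoment_by_parts {a b ζ : ℝ} (ha : a ≤ 1) (hb : 0 < b) (hζ : 0 < ζ) :
    ζ * hankelMoment a b ζ =
      b * hankelMoment a (b - 1) ζ + Complex.I / 2 * a * hankelMoment (a - 1) b ζ := by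
  have hi0 := integrableOn_hankelKernel (b := b) ha (by linarith) hζ
  have hi1 := (integrableOn_hankelKernel (b := b - 1) ha (by linarith) hζ).const_mul (b : ℂ)
  have hi2 := (integrableOn_hankelKernel (a := a - 1) (b := b) (by linarith) (by linarith)
    hζ).const_mul (Complex.I / 2 * a)
  have hi3 := hi0.const_mul (ζ : ℂ)
  have hd : ∀ s ∈ Ioi (0 : ℝ), HasDerivAt (hankelKernel a b ζ)
      (b * hankelKernel a (b - 1) ζ s + Complex.I / 2 * a * hankelKernel (a - 1) b ζ s -
        ζ * hankelKernel a b ζ s) s := by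
    intro s hs
    have hs' : (0 : ℝ) < s := hs
    have h1 := (hasDerivAt_rpow_const (x := s) (p := b) (.inl hs'.ne')).mul
      (((hasDerivAt_id s).const_mul ζ).neg).exp
    have h2 := h1.ofReal_comp.mul (hasDerivAt_hankelLine_cpow a s)
    refine h2.congr_deriv ?_
    simp only [hankelKernel, id, Pi.mul_apply, Pi.neg_apply]
    push_cast
    ring_nf
  have hint := (hi1.add hi2).sub hi3
  have hlim := tendsto_zero_of_hasDerivAt_of_integrableOn_Ioi hd hint hi0
  have hcont : ContinuousWithinAt (hankelKernel a b ζ) (Ici 0) 0 := by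
    have := continuous_hankelLine_cpow a
    have h3 : Continuous fun s : ℝ => s ^ b := continuous_id.rpow_const fun _ => .inr hb.le
    have : Continuous (hankelKernel a b ζ) := by unfold hankelKernel; fun_prop
    exact this.continuousWithinAt
  have h := integral_Ioi_of_hasDerivAt_of_tendsto hcont hd hint hlim
  have h0 : hankelKernel a b ζ 0 = 0 := by simp [hankelKernel, zero_rpow hb.ne']
  have hi12 : Integrable (fun s => b * hankelKernel a (b - 1) ζ s +
    Complex.I / 2 * a * hankelKernel (a - 1) b ζ s) (volume.restrict (Ioi 0)) := hi1.add hi2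
  rw [integral_sub hi12 hi3, integral_add hi1 hi2, integral_const_mul,
    integral_const_mul, integral_const_mul, h0] at h
  unfold hankelMoment
  linear_combination -h

lemma norm_hankelMoment_sub_le {a b ζ : ℝ} (ha : a ≤ 1) (hb : -1 < b) (hζ : 0 < ζ) :
    ‖hankelMoment a b ζ - rpowLaplace b ζ‖ ≤ |a| / 2 * ((b + 1) / ζ) * rpowLaplace b ζ := by
  have h0 := integrableOn_rpow_mul_exp hb hζ
  have h1 := integrableOn_rpow_mul_exp (b := b + 1) (by linarith) hζ
  have h2 : Integrable (fun s : ℝ => ((s ^ b * exp (-(ζ * s)) : ℝ) : ℂ))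
    (volume.restrict (Ioi 0)) := h0.ofReal
  rw [mul_assoc, ← rpowLaplace_add_one hb hζ, rpowLaplace, rpowLaplace, ← integral_const_mul,
    hankelMoment, ← integral_complex_ofReal, ← integral_sub (integrableOn_hankelKernel ha hb hζ) h2]
  refine norm_integral_le_of_norm_le (h1.const_mul _) ?_
  filter_upwards [ae_restrict_mem measurableSet_Ioi] with s hs
  have hs' : (0 : ℝ) < s := hs
  rw [hankelKernel, ← mul_sub_one, norm_mul, Complex.norm_real, norm_of_nonneg (by positivity),
    rpow_add_one hs'.ne']
  calc _ ≤ s ^ b * exp (-(ζ * s)) * (|a| / 2 * s) := by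
        gcongr; exact norm_hankelLine_cpow_sub_one_le ha hs'.le
    _ = _ := by ring

lemma mul_hankelMoment_add_one {a ζ : ℝ} (ha : a ≤ 0) (ha' : -1 < a) (hζ : 0 < ζ) :
    ζ * hankelMoment (a + 1) (a + 1) ζ =
      (a + 1) * (hankelMoment a a ζ + Complex.I * hankelMoment a (a + 1) ζ) := by
  have h1 := hankelMoment_by_parts (a := a + 1) (b := a + 1) (by linarith) (by linarith) hζ
  rw [add_sub_cancel_right, hankelMoment_add_one_left ha ha' hζ] at h1
  rw [h1]
  push_cast
  ring

lemma hankelMoment_three_term {a ζ : ℝ} (ha : a ≤ 0) (ha' : -1 < a) (hζ : 0 < ζ) :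
    ζ * (hankelMoment a (a + 1) ζ + Complex.I / 2 * hankelMoment a (a + 1 + 1) ζ) =
      (a + 1) * (hankelMoment a a ζ + Complex.I * hankelMoment a (a + 1) ζ) := by
  rw [← mul_hankelMoment_add_one ha ha' hζ,
    hankelMoment_add_one_left (b := a + 1) ha (by linarith) hζ]

lemma Complex.ofReal_mul_cpow_ofReal {r : ℝ} (hr : 0 < r) {z : ℂ} (hz : z ≠ 0) (a : ℝ) :
    ((r : ℂ) * z) ^ (a : ℂ) = ((r ^ a : ℝ) : ℂ) * z ^ (a : ℂ) := by
  rw [Complex.cpow_def_of_ne_zero (mul_ne_zero (by exact_mod_cast hr.ne') hz),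
    Complex.log_ofReal_mul hr hz, add_mul, Complex.exp_add, ← Complex.cpow_def_of_ne_zero hz,
    ← Complex.ofReal_mul, ← Complex.ofReal_exp, ← rpow_def_of_pos hr]

lemma rpow_mul_hankelMoment {a ζ : ℝ} (hζ : 0 < ζ) :
    ((ζ ^ (1 + 2 * a) : ℝ) : ℂ) * hankelMoment a a ζ =
      ∫ t in Ioi (0 : ℝ), ((t ^ a * exp (-t) : ℝ) : ℂ) *
        ((ζ : ℂ) + ((t / 2 : ℝ) : ℂ) * Complex.I) ^ (a : ℂ) := by
  have h := integral_comp_mul_left_Ioi (fun t : ℝ => ((t ^ a * exp (-t) : ℝ) : ℂ) *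
        ((ζ : ℂ) + ((t / 2 : ℝ) : ℂ) * Complex.I) ^ (a : ℂ)) 0 hζ
  have e : ∫ s in Ioi (0 : ℝ), (fun t : ℝ => ((t ^ a * exp (-t) : ℝ) : ℂ) *
        ((ζ : ℂ) + ((t / 2 : ℝ) : ℂ) * Complex.I) ^ (a : ℂ)) (ζ * s) =
      ((ζ ^ (2 * a) : ℝ) : ℂ) * hankelMoment a a ζ := by
    rw [hankelMoment, ← integral_const_mul]
    refine setIntegral_congr_fun measurableSet_Ioi fun s hs => ?_
    have hs' : (0 : ℝ) < s := hs
    have h1 : ((ζ : ℂ) + ((ζ * s / 2 : ℝ) : ℂ) * Complex.I) = (ζ : ℂ) * hankelLine s := by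
      simp only [hankelLine]; push_cast; ring
    have h2 : ((ζ : ℂ) * hankelLine s) ^ (a : ℂ) = ((ζ ^ a : ℝ) : ℂ) * hankelLine s ^ (a : ℂ) :=
      Complex.ofReal_mul_cpow_ofReal hζ (hankelLine_ne_zero s) a
    simp only [h1, h2, hankelKernel, mul_rpow hζ.le hs'.le, two_mul, rpow_add hζ]
    push_cast
    ring
  rw [e, mul_zero] at h
  rw [rpow_add hζ, rpow_one, Complex.ofReal_mul, mul_assoc, h, Complex.real_smul,
    Complex.ofReal_inv, mul_inv_cancel_left₀ (by exact_mod_cast hζ.ne')]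

lemma Complex.I_cpow_ofReal (a : ℝ) :
    Complex.I ^ (a : ℂ) = Complex.exp (((π / 2 * a : ℝ) : ℂ) * Complex.I) := by
  rw [Complex.cpow_def_of_ne_zero Complex.I_ne_zero, Complex.log_I]
  congr 1
  push_cast
  ring

lemma exists_tendsto_rpow_mul_hankelMoment {a : ℝ} (ha : a ≤ 1) (ha' : -1 / 2 < a) :
    ∃ r : ℝ, Tendsto (fun ζ : ℝ => ((ζ ^ (1 + 2 * a) : ℝ) : ℂ) * hankelMoment a a ζ) (𝓝[>] 0)
      (𝓝 (r * Complex.exp (((π / 2 * a : ℝ) : ℂ) * Complex.I))) := by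
  refine ⟨∫ t in Ioi (0 : ℝ), t ^ a * exp (-t) * (t / 2) ^ a, ?_⟩
  have hlim := tendsto_integral_filter_of_dominated_convergence (μ := volume.restrict (Ioi (0 : ℝ)))
    (l := 𝓝[>] (0 : ℝ))
    (F := fun ζ t => ((t ^ a * exp (-t) : ℝ) : ℂ) *
        ((ζ : ℂ) + ((t / 2 : ℝ) : ℂ) * Complex.I) ^ (a : ℂ))
    (f := fun t => ((t ^ a * exp (-t) * (t / 2) ^ a : ℝ) : ℂ) *
      Complex.exp (((π / 2 * a : ℝ) : ℂ) * Complex.I))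
    (fun t => t ^ a * exp (-t) * ((t / 2) ^ a + (1 + t / 2))) ?_ ?_ ?_ ?_
  · rw [integral_mul_const, integral_complex_ofReal] at hlim
    refine hlim.congr' ?_
    filter_upwards [self_mem_nhdsWithin] with ζ hζ
    exact (rpow_mul_hankelMoment hζ).symm
  · refine .of_forall fun ζ => Measurable.aestronglyMeasurable ?_
    fun_prop
  · filter_upwards [Ioo_mem_nhdsGT (one_pos (α := ℝ))] with ζ hζ
    filter_upwards [ae_restrict_mem measurableSet_Ioi] with t ht
    have ht' : (0 : ℝ) < t := ht
    rw [norm_mul, Complex.norm_real, norm_of_nonneg (by positivity), Complex.norm_cpow_real]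
    have hlow : t / 2 ≤ ‖(ζ : ℂ) + ((t / 2 : ℝ) : ℂ) * Complex.I‖ := by
      simpa using Complex.im_le_norm ((ζ : ℂ) + ((t / 2 : ℝ) : ℂ) * Complex.I)
    have hup : ‖(ζ : ℂ) + ((t / 2 : ℝ) : ℂ) * Complex.I‖ ≤ 1 + t / 2 := by
      refine (norm_add_le _ _).trans ?_
      rw [norm_mul, Complex.norm_I, Complex.norm_real, Complex.norm_real,
        norm_of_nonneg hζ.1.le, norm_of_nonneg (half_pos ht').le, mul_one]
      linarith [hζ.2]
    gcongr
    rcases le_total a 0 with h | h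
    · have := rpow_le_rpow_of_nonpos (by positivity) hlow h
      linarith
    · calc _ ≤ (1 + t / 2) ^ a := rpow_le_rpow (norm_nonneg _) hup h
        _ ≤ (1 + t / 2) ^ (1 : ℝ) := rpow_le_rpow_of_exponent_le (by linarith) ha
        _ ≤ _ := by rw [rpow_one]; linarith [rpow_nonneg (half_pos ht').le a]
  · have h1 := (integrableOn_rpow_mul_exp (b := a + a) (ζ := 1) (by linarith) one_pos).const_mul
      ((2 : ℝ) ^ (-a))
    have h2 := integrableOn_hankelKernel_bound (b := a) (ζ := 1) (by linarith) one_pos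
    refine (h1.add h2).congr ?_
    filter_upwards [ae_restrict_mem measurableSet_Ioi] with t ht
    have ht' : (0 : ℝ) < t := ht
    simp only [Pi.add_apply, one_mul, rpow_add ht', div_rpow ht'.le zero_le_two, rpow_one,
      rpow_neg zero_le_two]
    ring
  · filter_upwards [ae_restrict_mem measurableSet_Ioi] with t ht
    have ht' : (0 : ℝ) < t := ht
    have hc : ContinuousAt (fun ζ : ℝ => ((t ^ a * exp (-t) : ℝ) : ℂ) *
        ((ζ : ℂ) + ((t / 2 : ℝ) : ℂ) * Complex.I) ^ (a : ℂ)) 0 := by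
      refine continuousAt_const.mul (ContinuousAt.cpow (by fun_prop) continuousAt_const ?_)
      right
      simpa using ht'.ne'
    have h := hc.tendsto.mono_left (nhdsWithin_le_nhds (s := Ioi 0))
    convert h using 2
    rw [Complex.ofReal_zero, zero_add, Complex.ofReal_mul_cpow_ofReal (half_pos ht') Complex.I_ne_zero,
      Complex.I_cpow_ofReal]
    push_cast
    ring

/-- The phase `(2/3) x ^ (3/2)` of the Airy functions at `-x`. -/
noncomputable def airyPhase (x : ℝ) : ℝ := 2 / 3 * x ^ ((3 : ℝ) / 2)

lemma airyPhase_pos {x : ℝ} (hx : 0 < x) : 0 < airyPhase x := by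
  unfold airyPhase; positivity

lemma airyPhase_eq {x : ℝ} (hx : 0 < x) : airyPhase x = 2 / 3 * √x ^ 3 := by
  rw [airyPhase, sqrt_eq_rpow, ← rpow_natCast, ← rpow_mul hx.le]
  norm_num

lemma hasDerivAt_airyPhase {x : ℝ} (hx : 0 < x) : HasDerivAt airyPhase (√x) x := by
  have h := (hasDerivAt_rpow_const (x := x) (p := (3 : ℝ) / 2) (.inl hx.ne')).const_mul (2 / 3)
  refine h.congr_deriv ?_
  rw [sqrt_eq_rpow]
  norm_num
  ring

lemma lt_airyPhase {c x : ℝ} (hc : 0 ≤ c) (h : (3 / 2 * c) ^ ((2 : ℝ) / 3) < x) :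
    c < airyPhase x := by
  have h1 := rpow_lt_rpow (by positivity) h (show (0 : ℝ) < 3 / 2 by norm_num)
  rw [← rpow_mul (by positivity)] at h1
  norm_num at h1
  rw [airyPhase]
  linarith

lemma airyPhase_lt {c x : ℝ} (hc : 0 ≤ c) (hx : 0 ≤ x) (h : x < (3 / 2 * c) ^ ((2 : ℝ) / 3)) :
    airyPhase x < c := by
  have h1 := rpow_lt_rpow hx h (show (0 : ℝ) < 3 / 2 by norm_num)
  rw [← rpow_mul (by positivity)] at h1
  norm_num at h1
  rw [airyPhase]
  linarith

lemma rpow_airyPhase {x p : ℝ} (hx : 0 < x) :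
    airyPhase x ^ p = (2 / 3) ^ p * x ^ (3 / 2 * p) := by
  rw [airyPhase, mul_rpow (by norm_num) (by positivity), ← rpow_mul hx.le]

lemma tendsto_airyPhase : Tendsto airyPhase (𝓝[>] 0) (𝓝[>] 0) := by
  refine tendsto_nhdsWithin_iff.2 ⟨?_, ?_⟩
  · have hc : ContinuousAt airyPhase 0 :=
      continuousAt_const.mul (continuousAt_id.rpow_const (.inr (by norm_num)))
    have := hc.tendsto
    rw [show airyPhase 0 = 0 by simp [airyPhase]] at this
    exact this.mono_left nhdsWithin_le_nhds
  · filter_upwards [self_mem_nhdsWithin] with x hx using airyPhase_pos hx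

/-- The oscillating factor `exp (i (2/3) x ^ (3/2))`. -/
noncomputable def airyWave (x : ℝ) : ℂ := Complex.exp (airyPhase x * Complex.I)

lemma hasDerivAt_airyWave {x : ℝ} (hx : 0 < x) :
    HasDerivAt airyWave (airyWave x * (√x * Complex.I)) x :=
  ((hasDerivAt_airyPhase hx).ofReal_comp.mul_const Complex.I).cexp

lemma hasDerivAt_hankelMoment_airyPhase {a b x : ℝ} (ha : a ≤ 1) (hb : -1 < b) (hx : 0 < x) :
    HasDerivAt (fun x => hankelMoment a b (airyPhase x))
      (-(√x * hankelMoment a (b + 1) (airyPhase x))) x := by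
  have h := (hasDerivAt_hankelMoment ha hb (airyPhase_pos hx)).scomp x (hasDerivAt_airyPhase hx)
  refine h.congr_deriv ?_
  simp

lemma tendsto_im_rotated {f : ℝ → ℂ} {l : Filter ℝ} {r c : ℝ}
    (h : Tendsto f l (𝓝 (r * Complex.exp (c * Complex.I)))) :
    Tendsto (fun x => (Complex.exp (((-c : ℝ) : ℂ) * Complex.I) * f x).im) l (𝓝 0) := by
  have h1 := (Complex.continuous_im.tendsto _).comp
    (h.const_mul (Complex.exp (((-c : ℝ) : ℂ) * Complex.I)))
  rw [mul_left_comm, ← Complex.exp_add, ← add_mul, ← Complex.ofReal_add] at h1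
  simpa [Function.comp_def] using h1

lemma exists_tendsto_airyWave_mul {a : ℝ} (ha : a ≤ 1) (ha' : -1 / 2 < a) :
    ∃ r : ℝ, Tendsto (fun x : ℝ => ((x ^ (3 / 2 * (1 + 2 * a)) : ℝ) : ℂ) *
      (airyWave x * hankelMoment a a (airyPhase x))) (𝓝[>] 0)
      (𝓝 (r * Complex.exp (((π / 2 * a : ℝ) : ℂ) * Complex.I))) := by
  obtain ⟨r, hr⟩ := exists_tendsto_rpow_mul_hankelMoment ha ha'
  refine ⟨(2 / 3) ^ (-(1 + 2 * a)) * r, ?_⟩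
  have h1 := hr.comp tendsto_airyPhase
  have h2 : Tendsto airyWave (𝓝[>] 0) (𝓝 1) := by
    have hc : Continuous fun y : ℝ => Complex.exp (y * Complex.I) := by fun_prop
    have := (hc.tendsto 0).comp (tendsto_airyPhase.mono_right nhdsWithin_le_nhds)
    rw [Complex.ofReal_zero, zero_mul, Complex.exp_zero] at this
    exact this
  have h3 := (h2.mul h1).const_mul ((((2 : ℝ) / 3) ^ (-(1 + 2 * a)) : ℝ) : ℂ)
  rw [one_mul, ← mul_assoc, ← Complex.ofReal_mul] at h3
  refine h3.congr' ?_
  filter_upwards [self_mem_nhdsWithin] with x hx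
  have hq : (((2 : ℝ) / 3) ^ (-(1 + 2 * a)) : ℝ) * ((2 : ℝ) / 3) ^ (1 + 2 * a) = 1 := by
    rw [← rpow_add (by norm_num)]; simp
  have hq' := congrArg (fun y : ℝ => (y : ℂ)) hq
  simp only [Function.comp, rpow_airyPhase hx]
  push_cast at hq' ⊢
  linear_combination ((x ^ (3 / 2 * (1 + 2 * a)) : ℝ) : ℂ) *
      (airyWave x * hankelMoment a a (airyPhase x)) * hq'

lemma mul_sqrt_eq_airyPhase {x : ℝ} (hx : 0 < x) : x * √x = 3 / 2 * airyPhase x := by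
  rw [airyPhase_eq hx]
  nth_rewrite 1 [← sq_sqrt hx.le]
  ring

/-- A complex solution of `w'' = -x w`, proportional to `√x` times the Hankel function of order
`1/3` at `airyPhase x`, written as a Laplace integral with exponent `-1/6`. -/
noncomputable def airyHankel (x : ℝ) : ℂ :=
  x * (airyWave x * hankelMoment (-1 / 6) (-1 / 6) (airyPhase x))

/-- The derivative of `airyHankel`. -/
noncomputable def airyHankelDeriv (x : ℝ) : ℂ :=
  airyWave x * (hankelMoment (-1 / 6) (-1 / 6) (airyPhase x) + 3 / 2 * airyPhase x *
    (Complex.I * hankelMoment (-1 / 6) (-1 / 6) (airyPhase x) -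
      hankelMoment (-1 / 6) (-1 / 6 + 1) (airyPhase x)))

/-- A complex solution of `w'' = -x w`, proportional to `√x` times the Hankel function of order
`-1/3` at `airyPhase x`, written as a Laplace integral with exponent `-5/6`. -/
noncomputable def airyHankelNeg (x : ℝ) : ℂ :=
  airyWave x * hankelMoment (-5 / 6) (-5 / 6) (airyPhase x)

/-- The derivative of `airyHankelNeg`. -/
noncomputable def airyHankelNegDeriv (x : ℝ) : ℂ :=
  √x * (airyWave x * (Complex.I * hankelMoment (-5 / 6) (-5 / 6) (airyPhase x) -
    hankelMoment (-5 / 6) (-5 / 6 + 1) (airyPhase x)))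

lemma hasDerivAt_airyHankel {x : ℝ} (hx : 0 < x) :
    HasDerivAt airyHankel (airyHankelDeriv x) x := by
  have h := (hasDerivAt_id x).ofReal_comp.mul ((hasDerivAt_airyWave hx).mul
    (hasDerivAt_hankelMoment_airyPhase (a := -1 / 6) (b := -1 / 6) (by norm_num) (by norm_num) hx))
  refine h.congr_deriv ?_
  have e := congrArg (fun y : ℝ => (y : ℂ)) (mul_sqrt_eq_airyPhase hx)
  push_cast at e
  simp only [airyHankelDeriv, id, Pi.mul_apply]
  push_cast
  linear_combination airyWave x * (Complex.I * hankelMoment (-1 / 6) (-1 / 6) (airyPhase x) -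
      hankelMoment (-1 / 6) (-1 / 6 + 1) (airyPhase x)) * e

lemma hasDerivAt_airyHankelDeriv {x : ℝ} (hx : 0 < x) :
    HasDerivAt airyHankelDeriv (-(x * airyHankel x)) x := by
  have h0 := hasDerivAt_hankelMoment_airyPhase (a := -1 / 6) (b := -1 / 6) (by norm_num)
    (by norm_num) hx
  have h1 := hasDerivAt_hankelMoment_airyPhase (a := -1 / 6) (b := -1 / 6 + 1) (by norm_num)
    (by norm_num) hx
  have h := (hasDerivAt_airyWave hx).mul (h0.add
    (((hasDerivAt_airyPhase hx).ofReal_comp.const_mul (3 / 2 : ℂ)).mul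
      ((h0.const_mul Complex.I).sub h1)))
  refine h.congr_deriv ?_
  have e := congrArg (fun y : ℝ => (y : ℂ)) (mul_sqrt_eq_airyPhase hx)
  have e2 := congrArg (fun y : ℝ => (y : ℂ)) (sq_sqrt hx.le)
  have t := hankelMoment_three_term (a := -1 / 6) (by norm_num) (by norm_num) (airyPhase_pos hx)
  simp only [airyHankel, Pi.mul_apply, Pi.add_apply, Pi.sub_apply]
  push_cast at e e2 t ⊢
  generalize hankelMoment (-1 / 6) (-1 / 6) (airyPhase x) = m0 at *
  generalize hankelMoment (-1 / 6) (-1 / 6 + 1) (airyPhase x) = m1 at *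
  generalize hankelMoment (-1 / 6) (-1 / 6 + 1 + 1) (airyPhase x) = m2 at *
  generalize airyWave x = W at *
  generalize (√x : ℂ) = r at *
  generalize (airyPhase x : ℂ) = z at *
  linear_combination (-3 * Complex.I * W * r) * t + (W * r * m0) * e - (W * m0 * x) * e2 +
    (W * r * (3 / 2 * z * m0 + 3 / 2 * z * m2 - 5 / 2 * m1)) * Complex.I_sq

lemma hasDerivAt_airyHankelNeg {x : ℝ} (hx : 0 < x) :
    HasDerivAt airyHankelNeg (airyHankelNegDeriv x) x := by
  have h := (hasDerivAt_airyWave hx).mul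
    (hasDerivAt_hankelMoment_airyPhase (a := -5 / 6) (b := -5 / 6) (by norm_num) (by norm_num) hx)
  refine h.congr_deriv ?_
  simp only [airyHankelNegDeriv]
  ring

lemma hasDerivAt_airyHankelNegDeriv {x : ℝ} (hx : 0 < x) :
    HasDerivAt airyHankelNegDeriv (-(x * airyHankelNeg x)) x := by
  have h0 := hasDerivAt_hankelMoment_airyPhase (a := -5 / 6) (b := -5 / 6) (by norm_num)
    (by norm_num) hx
  have h1 := hasDerivAt_hankelMoment_airyPhase (a := -5 / 6) (b := -5 / 6 + 1) (by norm_num)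
    (by norm_num) hx
  have h := (hasDerivAt_sqrt hx.ne').ofReal_comp.mul ((hasDerivAt_airyWave hx).mul
    ((h0.const_mul Complex.I).sub h1))
  refine h.congr_deriv ?_
  have e := congrArg (fun y : ℝ => (y : ℂ)) (airyPhase_eq hx)
  have e2 := congrArg (fun y : ℝ => (y : ℂ)) (sq_sqrt hx.le)
  have t := hankelMoment_three_term (a := -5 / 6) (by norm_num) (by norm_num) (airyPhase_pos hx)
  have hr : (√x : ℂ) ≠ 0 := by exact_mod_cast (sqrt_pos.2 hx).ne'
  simp only [airyHankelNeg, Pi.mul_apply, Pi.sub_apply]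
  push_cast at e e2 t ⊢
  rw [e] at t
  rw [← e2]
  generalize hankelMoment (-5 / 6) (-5 / 6) (airyPhase x) = m0 at *
  generalize hankelMoment (-5 / 6) (-5 / 6 + 1) (airyPhase x) = m1 at *
  generalize hankelMoment (-5 / 6) (-5 / 6 + 1 + 1) (airyPhase x) = m2 at *
  generalize airyWave x = W at *
  generalize (√x : ℂ) = r at *
  field_simp
  linear_combination (-6 * Complex.I * W) * t +
    (W * (2 * r ^ 3 * m0 + 2 * r ^ 3 * m2 - m1)) * Complex.I_sq

lemma airyHankelNegDeriv_eq {x : ℝ} (hx : 0 < x) :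
    airyHankelNegDeriv x = 6 * airyPhase x * √x * (airyWave x *
      (Complex.I * hankelMoment (1 / 6) (1 / 6) (airyPhase x))) := by
  have t := mul_hankelMoment_add_one (a := -5 / 6) (by norm_num) (by norm_num) (airyPhase_pos hx)
  rw [show hankelMoment (-5 / 6 + 1) (-5 / 6 + 1) (airyPhase x) =
    hankelMoment (1 / 6) (1 / 6) (airyPhase x) by norm_num] at t
  rw [airyHankelNegDeriv]
  push_cast at t
  linear_combination (-6 * √x * airyWave x * Complex.I) * t -
    (√x * airyWave x * hankelMoment (-5 / 6) (-5 / 6 + 1) (airyPhase x)) * Complex.I_sq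

lemma tendsto_im_airyHankel :
    Tendsto (fun x => (Complex.exp (((π / 12 : ℝ) : ℂ) * Complex.I) * airyHankel x).im)
      (𝓝[>] 0) (𝓝 0) := by
  obtain ⟨r, hr⟩ := exists_tendsto_airyWave_mul (a := -1 / 6) (by norm_num) (by norm_num)
  have h := tendsto_im_rotated hr
  refine h.congr fun x => ?_
  rw [airyHankel, show (3 : ℝ) / 2 * (1 + 2 * (-1 / 6)) = 1 by norm_num, rpow_one,
    show -(π / 2 * (-1 / 6)) = π / 12 by ring]

lemma tendsto_im_airyHankelNegDeriv :
    Tendsto (fun x => (Complex.exp (((-(7 * π / 12) : ℝ) : ℂ) * Complex.I) *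
      airyHankelNegDeriv x).im) (𝓝[>] 0) (𝓝 0) := by
  obtain ⟨r, hr⟩ := exists_tendsto_airyWave_mul (a := 1 / 6) (by norm_num) (by norm_num)
  have h := (hr.const_mul (4 * Complex.I))
  rw [show 4 * Complex.I * (r * Complex.exp (((π / 2 * (1 / 6) : ℝ) : ℂ) * Complex.I)) =
    ((4 * r : ℝ) : ℂ) * Complex.exp (((7 * π / 12 : ℝ) : ℂ) * Complex.I) by
      rw [show ((7 * π / 12 : ℝ) : ℂ) * Complex.I = π / 2 * Complex.I +
        ((π / 2 * (1 / 6) : ℝ) : ℂ) * Complex.I by push_cast; ring, Complex.exp_add,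
        Complex.exp_pi_div_two_mul_I]
      push_cast
      ring] at h
  refine (tendsto_im_rotated h).congr' ?_
  filter_upwards [self_mem_nhdsWithin] with x hx
  have hx' : (0 : ℝ) < x := hx
  have e : 2 / 3 * x ^ ((3 : ℝ) / 2 * (1 + 2 * (1 / 6))) = airyPhase x * √x := by
    rw [airyPhase, sqrt_eq_rpow, mul_assoc, ← rpow_add hx']
    norm_num
  have e' := congrArg (fun y : ℝ => (y : ℂ)) e
  rw [airyHankelNegDeriv_eq hx']
  congr 2
  push_cast at e' ⊢
  linear_combination 6 * (airyWave x * (Complex.I * hankelMoment (1 / 6) (1 / 6) (airyPhase x))) * e'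

lemma airyPhase_zero_estimate {ψ ε G : ℝ} {z : ℂ} {n : ℕ} (hG : 0 < G) (hψ : |ψ| ≤ π / 12)
    (hz : ‖z - G‖ ≤ ε * G)
    (h : (Complex.exp (((ψ + n * π : ℝ) : ℂ) * Complex.I) * z).im = 0) : |ψ| ≤ 9 / 8 * ε := by
  have he : Complex.exp (((ψ + n * π : ℝ) : ℂ) * Complex.I) =
      ((-1) ^ n : ℝ) * Complex.exp (ψ * Complex.I) := by
    push_cast
    rw [add_mul, Complex.exp_add, mul_assoc (n : ℂ), Complex.exp_nat_mul, Complex.exp_pi_mul_I,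
      mul_comm]
  rw [he, mul_assoc, Complex.im_ofReal_mul] at h
  have h0 : (Complex.exp (ψ * Complex.I) * z).im = 0 := by
    rcases mul_eq_zero.1 h with h | h
    · exact absurd h (by simp)
    · exact h
  have h1 : (Complex.exp (ψ * Complex.I) * (z - G)).im = -(sin ψ * G) := by
    rw [mul_sub, Complex.sub_im, h0, Complex.im_mul_ofReal, Complex.exp_ofReal_mul_I_im, zero_sub]
  have h2 : |sin ψ| * G ≤ ε * G := by
    have := (Complex.abs_im_le_norm (Complex.exp (ψ * Complex.I) * (z - G)))
    rw [h1, norm_mul, Complex.norm_exp_ofReal_mul_I, one_mul, abs_neg, abs_mul, abs_of_pos hG]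
      at this
    linarith
  have h3 : |sin ψ| ≤ ε := le_of_mul_le_mul_right h2 hG
  have hpi := pi_lt_d2
  have h4 : |sin ψ| = sin |ψ| := abs_sin_eq_sin_abs_of_abs_le_pi (by linarith [pi_pos])
  rcases (abs_nonneg ψ).eq_or_lt with h5 | h5
  · rw [← h5]; linarith [abs_nonneg (sin ψ)]
  · have h6 := sin_gt_sub_cube h5
    have h7 : |ψ| ≤ 1 / 2 := by linarith
    nlinarith [mul_pos h5 h5]

/-- The Wronskian of the canonical solutions of the Airy equation is `1`. -/
lemma airy_wronskian {u v u' v' : ℝ → ℝ}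
    (hu : ∀ x, HasDerivAt u (u' x) x) (huAiry : ∀ x, HasDerivAt u' (x * u x) x)
    (hv : ∀ x, HasDerivAt v (v' x) x) (hvAiry : ∀ x, HasDerivAt v' (x * v x) x)
    (hu0 : u 0 = 1) (hv0 : v 0 = 0) (hv'0 : v' 0 = 1) (x : ℝ) :
    u x * v' x - u' x * v x = 1 := by
  have hd : ∀ y, HasDerivAt (fun y => u y * v' y - u' y * v y) 0 y := fun y =>
    (((hu y).mul (hvAiry y)).sub ((huAiry y).mul (hv y))).congr_deriv (by ring)
  have := is_const_of_deriv_eq_zero (fun y => (hd y).differentiableAt) (fun y => (hd y).deriv) x 0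
  simpa [hu0, hv0, hv'0] using this

/-- A solution of `g'' = -x g` on the positive half-line has constant Wronskian with the reflection
of a solution of the Airy equation. -/
lemma airy_reflected_wronskian {g g' v v' : ℝ → ℝ}
    (hg : ∀ x, 0 < x → HasDerivAt g (g' x) x)
    (hg' : ∀ x, 0 < x → HasDerivAt g' (-(x * g x)) x)
    (hv : ∀ x, HasDerivAt v (v' x) x) (hvAiry : ∀ x, HasDerivAt v' (x * v x) x) :
    ∃ c, ∀ x, 0 < x → g x * v' (-x) + g' x * v (-x) = c := by
  have hd : ∀ x ∈ Ioi (0 : ℝ), HasDerivAt (fun x => g x * v' (-x) + g' x * v (-x)) 0 x := by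
    intro x hx
    have h1 := (hvAiry (-x)).scomp x (hasDerivAt_neg x)
    have h2 := (hv (-x)).scomp x (hasDerivAt_neg x)
    refine (((hg x hx).mul h1).add ((hg' x hx).mul h2)).congr_deriv ?_
    simp only [Function.comp, smul_eq_mul]
    ring
  obtain ⟨c, hc⟩ := isOpen_Ioi.exists_is_const_of_deriv_eq_zero isPreconnected_Ioi
    (fun x hx => (hd x hx).differentiableAt.differentiableWithinAt) (fun x hx => (hd x hx).deriv)
  exact ⟨c, fun x hx => hc x hx⟩

lemma airy_reflected_expansion {g g' u v u' v' : ℝ → ℝ}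
    (hg : ∀ x, 0 < x → HasDerivAt g (g' x) x)
    (hg' : ∀ x, 0 < x → HasDerivAt g' (-(x * g x)) x)
    (hu : ∀ x, HasDerivAt u (u' x) x) (huAiry : ∀ x, HasDerivAt u' (x * u x) x)
    (hv : ∀ x, HasDerivAt v (v' x) x) (hvAiry : ∀ x, HasDerivAt v' (x * v x) x)
    (hu0 : u 0 = 1) (hv0 : v 0 = 0) (hv'0 : v' 0 = 1) :
    ∃ α β : ℝ, ∀ x, 0 < x → g x = α * u (-x) - β * v (-x) ∧
      g' x = -(α * u' (-x)) + β * v' (-x) := by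
  obtain ⟨α, hα⟩ := airy_reflected_wronskian hg hg' hv hvAiry
  obtain ⟨β, hβ⟩ := airy_reflected_wronskian hg hg' hu huAiry
  refine ⟨α, β, fun x hx => ?_⟩
  have w := airy_wronskian hu huAiry hv hvAiry hu0 hv0 hv'0 (-x)
  have h1 := hα x hx
  have h2 := hβ x hx
  constructor
  · linear_combination (-g x) * w + u (-x) * h1 - v (-x) * h2
  · linear_combination (-g' x) * w - u' (-x) * h1 + v' (-x) * h2

/-- A reflected solution vanishing at the origin is a multiple of `v (-x)`. -/
lemma airy_reflected_eq_of_tendsto {g g' u v u' v' : ℝ → ℝ}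
    (hg : ∀ x, 0 < x → HasDerivAt g (g' x) x)
    (hg' : ∀ x, 0 < x → HasDerivAt g' (-(x * g x)) x)
    (hu : ∀ x, HasDerivAt u (u' x) x) (huAiry : ∀ x, HasDerivAt u' (x * u x) x)
    (hv : ∀ x, HasDerivAt v (v' x) x) (hvAiry : ∀ x, HasDerivAt v' (x * v x) x)
    (hu0 : u 0 = 1) (hv0 : v 0 = 0) (hv'0 : v' 0 = 1) (hlim : Tendsto g (𝓝[>] 0) (𝓝 0)) :
    ∃ β : ℝ, ∀ x, 0 < x → g x = β * v (-x) ∧ g' x = -(β * v' (-x)) := by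
  obtain ⟨α, β, h⟩ := airy_reflected_expansion hg hg' hu huAiry hv hvAiry hu0 hv0 hv'0
  have hcu : Continuous u := continuous_iff_continuousAt.2 fun x => (hu x).continuousAt
  have hcv : Continuous v := continuous_iff_continuousAt.2 fun x => (hv x).continuousAt
  have hc : Continuous fun x => α * u (-x) - β * v (-x) := by fun_prop
  have h1 := (hc.tendsto 0).mono_left (nhdsWithin_le_nhds (s := Ioi 0))
  have h2 : Tendsto (fun x => α * u (-x) - β * v (-x)) (𝓝[>] 0) (𝓝 0) := by
    refine hlim.congr' ?_
    filter_upwards [self_mem_nhdsWithin] with x hx using (h x hx).1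
  have hα : α = 0 := by simpa [hu0, hv0] using tendsto_nhds_unique h1 h2
  refine ⟨-β, fun x hx => ?_⟩
  obtain ⟨e1, e2⟩ := h x hx
  rw [e1, e2, hα]
  constructor <;> ring

/-- A reflected solution whose derivative vanishes at the origin is a multiple of `u (-x)`. -/
lemma airy_reflected_eq_of_tendsto_deriv {g g' u v u' v' : ℝ → ℝ}
    (hg : ∀ x, 0 < x → HasDerivAt g (g' x) x)
    (hg' : ∀ x, 0 < x → HasDerivAt g' (-(x * g x)) x)
    (hu : ∀ x, HasDerivAt u (u' x) x) (huAiry : ∀ x, HasDerivAt u' (x * u x) x)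
    (hv : ∀ x, HasDerivAt v (v' x) x) (hvAiry : ∀ x, HasDerivAt v' (x * v x) x)
    (hu0 : u 0 = 1) (hu'0 : u' 0 = 0) (hv0 : v 0 = 0) (hv'0 : v' 0 = 1)
    (hlim : Tendsto g' (𝓝[>] 0) (𝓝 0)) :
    ∃ α : ℝ, ∀ x, 0 < x → g x = α * u (-x) ∧ g' x = -(α * u' (-x)) := by
  obtain ⟨α, β, h⟩ := airy_reflected_expansion hg hg' hu huAiry hv hvAiry hu0 hv0 hv'0
  have hcu : Continuous u' := continuous_iff_continuousAt.2 fun x => (huAiry x).continuousAt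
  have hcv : Continuous v' := continuous_iff_continuousAt.2 fun x => (hvAiry x).continuousAt
  have hc : Continuous fun x => -(α * u' (-x)) + β * v' (-x) := by fun_prop
  have h1 := (hc.tendsto 0).mono_left (nhdsWithin_le_nhds (s := Ioi 0))
  have h2 : Tendsto (fun x => -(α * u' (-x)) + β * v' (-x)) (𝓝[>] 0) (𝓝 0) := by
    refine hlim.congr' ?_
    filter_upwards [self_mem_nhdsWithin] with x hx using (h x hx).2
  have hβ : β = 0 := by simpa [hu'0, hv'0] using tendsto_nhds_unique h1 h2
  refine ⟨α, fun x hx => ?_⟩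
  obtain ⟨e1, e2⟩ := h x hx
  rw [e1, e2, hβ]
  constructor <;> ring

lemma hasDerivAt_im_const_mul {f : ℝ → ℂ} {f' : ℂ} {x : ℝ} (c : ℂ) (h : HasDerivAt f f' x) :
    HasDerivAt (fun x => (c * f x).im) (c * f').im x :=
  (Complex.imCLM.hasFDerivAt.comp_hasDerivAt x (h.const_mul c))

lemma exp_mul_airyWave {c ψ x : ℝ} {n : ℕ} (h : airyPhase x + c = ψ + n * π) :
    Complex.exp ((c : ℂ) * Complex.I) * airyWave x =
      Complex.exp (((ψ + n * π : ℝ) : ℂ) * Complex.I) := by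
  rw [airyWave, ← Complex.exp_add, ← h]
  congr 1
  push_cast
  ring

lemma exp_mul_I_mul_airyWave {c ψ x : ℝ} {n : ℕ} (h : airyPhase x + c + π / 2 = ψ + n * π) :
    Complex.exp ((c : ℂ) * Complex.I) * airyWave x * Complex.I =
      Complex.exp (((ψ + n * π : ℝ) : ℂ) * Complex.I) := by
  rw [airyWave, ← h, show ((airyPhase x + c + π / 2 : ℝ) : ℂ) * Complex.I =
    c * Complex.I + airyPhase x * Complex.I + π / 2 * Complex.I by push_cast; ring,
    Complex.exp_add, Complex.exp_add, Complex.exp_pi_div_two_mul_I]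

lemma im_eq_zero_of_ofReal_mul {r : ℝ} (hr : r ≠ 0) {z : ℂ} (h : ((r : ℂ) * z).im = 0) :
    z.im = 0 := by
  rw [Complex.im_ofReal_mul] at h
  exact (mul_eq_zero.1 h).resolve_left hr

lemma airyHankel_zero_estimate {ψ x : ℝ} {n : ℕ} (hx : 0 < x) (hψ : |ψ| ≤ π / 12)
    (hp : airyPhase x + π / 12 = ψ + n * π)
    (h : (Complex.exp (((π / 12 : ℝ) : ℂ) * Complex.I) * airyHankel x).im = 0) :
    |ψ| ≤ 5 / 64 / airyPhase x := by
  have hζ := airyPhase_pos hx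
  have hz := norm_hankelMoment_sub_le (a := -1 / 6) (b := -1 / 6) (by norm_num) (by norm_num) hζ
  refine (airyPhase_zero_estimate (n := n) (rpowLaplace_pos (by norm_num) hζ) hψ hz ?_).trans
    (le_of_eq ?_)
  · rw [← exp_mul_airyWave hp]
    refine im_eq_zero_of_ofReal_mul hx.ne' ?_
    rw [← h, airyHankel]
    congr 1
    ring
  · norm_num [abs_of_neg]
    field_simp
    norm_num

lemma airyHankelNeg_zero_estimate {ψ x : ℝ} {n : ℕ} (hx : 0 < x) (hψ : |ψ| ≤ π / 12)
    (hp : airyPhase x + -(7 * π / 12) = ψ + n * π)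
    (h : (Complex.exp (((-(7 * π / 12) : ℝ) : ℂ) * Complex.I) * airyHankelNeg x).im = 0) :
    |ψ| ≤ 5 / 64 / airyPhase x := by
  have hζ := airyPhase_pos hx
  have hz := norm_hankelMoment_sub_le (a := -5 / 6) (b := -5 / 6) (by norm_num) (by norm_num) hζ
  refine (airyPhase_zero_estimate (n := n) (rpowLaplace_pos (by norm_num) hζ) hψ hz ?_).trans
    (le_of_eq ?_)
  · rw [← exp_mul_airyWave hp, ← h, airyHankelNeg, mul_assoc]
  · norm_num [abs_of_neg]
    field_simp
    norm_num

lemma airyHankelNegDeriv_zero_estimate {ψ x : ℝ} {n : ℕ} (hx : 0 < x) (hψ : |ψ| ≤ π / 12)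
    (hp : airyPhase x + -(7 * π / 12) + π / 2 = ψ + n * π)
    (h : (Complex.exp (((-(7 * π / 12) : ℝ) : ℂ) * Complex.I) * airyHankelNegDeriv x).im = 0) :
    |ψ| ≤ 7 / 64 / airyPhase x := by
  have hζ := airyPhase_pos hx
  have hz := norm_hankelMoment_sub_le (a := 1 / 6) (b := 1 / 6) (by norm_num) (by norm_num) hζ
  refine (airyPhase_zero_estimate (n := n) (rpowLaplace_pos (by norm_num) hζ) hψ hz ?_).trans
    (le_of_eq ?_)
  · rw [← exp_mul_I_mul_airyWave hp]
    refine im_eq_zero_of_ofReal_mul (r := 6 * airyPhase x * √x) (by positivity) ?_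
    rw [← h, airyHankelNegDeriv_eq hx]
    congr 1
    push_cast
    ring
  · norm_num [abs_of_pos]
    field_simp
    norm_num

lemma airyHankelDeriv_zero_estimate {ψ x : ℝ} {n : ℕ} (hx : 0 < x) (hψ : |ψ| ≤ π / 12)
    (hp : airyPhase x + π / 12 + π / 2 = ψ + n * π)
    (h : (Complex.exp (((π / 12 : ℝ) : ℂ) * Complex.I) * airyHankelDeriv x).im = 0) :
    |ψ| ≤ 9 / 8 * (17 / 72 / airyPhase x + 25 / 144 / airyPhase x ^ 2) := by
  have hζ := airyPhase_pos hx
  have h0 := norm_hankelMoment_sub_le (a := -1 / 6) (b := -1 / 6) (by norm_num) (by norm_num) hζ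
  have h1 := norm_hankelMoment_sub_le (a := -1 / 6) (b := -1 / 6 + 1) (by norm_num) (by norm_num) hζ
  have hG := rpowLaplace_pos (b := -1 / 6) (by norm_num) hζ
  rw [rpowLaplace_add_one (by norm_num) hζ] at h1
  have hζ' : (airyPhase x : ℂ) ≠ 0 := by exact_mod_cast hζ.ne'
  set m0 := hankelMoment (-1 / 6) (-1 / 6) (airyPhase x) with hm0
  set m1 := hankelMoment (-1 / 6) (-1 / 6 + 1) (airyPhase x) with hm1
  set G := rpowLaplace (-1 / 6) (airyPhase x) with hGdef
  set ζ := airyPhase x with hζdef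
  refine airyPhase_zero_estimate (n := n) (z := m0 + Complex.I * m1 -
    ((2 / 3 / ζ : ℝ) : ℂ) * (Complex.I * m0)) hG hψ ?_ ?_
  · have e : m0 + Complex.I * m1 - ((2 / 3 / ζ : ℝ) : ℂ) * (Complex.I * m0) - G =
        (m0 - G) + Complex.I * (m1 - (((-1 / 6 + 1) / ζ * G : ℝ) : ℂ)) -
          ((2 / 3 / ζ : ℝ) : ℂ) * (Complex.I * (m0 - G)) +
          ((1 / 6 / ζ * G : ℝ) : ℂ) * Complex.I := by
      push_cast
      field_simp
      ring
    have hA : ‖Complex.I * (m1 - (((-1 / 6 + 1) / ζ * G : ℝ) : ℂ))‖ ≤ 55 / 432 / ζ ^ 2 * G := by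
      rw [norm_mul, Complex.norm_I, one_mul]
      refine h1.trans (le_of_eq ?_)
      norm_num [abs_of_neg]
      field_simp
      norm_num
    have hB : ‖m0 - G‖ ≤ 5 / 72 / ζ * G := by
      refine h0.trans (le_of_eq ?_)
      norm_num [abs_of_neg]
      field_simp
      norm_num
    have hC : ‖((2 / 3 / ζ : ℝ) : ℂ) * (Complex.I * (m0 - G))‖ ≤ 2 / 3 / ζ * (5 / 72 / ζ * G) := by
      rw [norm_mul, norm_mul, Complex.norm_I, one_mul, Complex.norm_real,
        norm_of_nonneg (by positivity)]
      gcongr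
    have hD : ‖((1 / 6 / ζ * G : ℝ) : ℂ) * Complex.I‖ = 1 / 6 / ζ * G := by
      rw [norm_mul, Complex.norm_I, mul_one, Complex.norm_real, norm_of_nonneg (by positivity)]
    rw [e]
    refine (norm_add_le _ _).trans ?_
    rw [hD]
    have h2 := norm_sub_le ((m0 - G) + Complex.I * (m1 - (((-1 / 6 + 1) / ζ * G : ℝ) : ℂ)))
      (((2 / 3 / ζ : ℝ) : ℂ) * (Complex.I * (m0 - G)))
    have h3 := norm_add_le (m0 - G) (Complex.I * (m1 - (((-1 / 6 + 1) / ζ * G : ℝ) : ℂ)))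
    have h4 : (17 / 72 / ζ + 25 / 144 / ζ ^ 2) * G = 5 / 72 / ζ * G + 55 / 432 / ζ ^ 2 * G +
        2 / 3 / ζ * (5 / 72 / ζ * G) + 1 / 6 / ζ * G := by
      field_simp
      ring
    linarith
  · rw [← exp_mul_I_mul_airyWave hp]
    refine im_eq_zero_of_ofReal_mul (r := 3 / 2 * ζ) (by positivity) ?_
    rw [← h, airyHankelDeriv, ← hm0, ← hm1, ← hζdef]
    congr 1
    push_cast
    field_simp
    linear_combination (airyWave x * (3 * ζ * m1 - 2 * m0)) * Complex.I_sq

lemma mem_Icc_of_abs_sub_le {ζ p d : ℝ} (h : |ζ - p| ≤ d) : ζ ∈ Icc (p - d) (p + d) :=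
  ⟨by linarith [neg_le_of_abs_le h], by linarith [le_of_abs_le h]⟩

theorem stmt_3 (u v u' v' : ℝ → ℝ)
    (hu : ∀ x, HasDerivAt u (u' x) x)
    (huAiry : ∀ x, HasDerivAt u' (x * u x) x)
    (hv : ∀ x, HasDerivAt v (v' x) x)
    (hvAiry : ∀ x, HasDerivAt v' (x * v x) x)
    (hu0 : u 0 = 1) (hu'0 : u' 0 = 0) (hv0 : v 0 = 0) (hv'0 : v' 0 = 1) :
    ∀ j : ℕ, ∀ x : ℝ, 0 < x →
      -- (1) zeros of v'
      ((v' (-x) = 0 →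
          x ∈ Ioo (((3:ℝ)/2 * ((j : ℝ) * π + π/3)) ^ ((2:ℝ)/3))
                  (((3:ℝ)/2 * ((j : ℝ) * π + π/2)) ^ ((2:ℝ)/3)) →
          (2:ℝ)/3 * x ^ ((3:ℝ)/2) ∈
            Icc (5*π/12 + (j : ℝ)*π - 7/(12*((j : ℝ)*π + π/3)))
                (5*π/12 + (j : ℝ)*π + 7/(12*((j : ℝ)*π + π/3)))) ∧
      -- (2) zeros of v
      (v (-x) = 0 →
          x ∈ Ioo (((3:ℝ)/2 * ((j : ℝ) * π + 5*π/6)) ^ ((2:ℝ)/3))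
                  (((3:ℝ)/2 * ((j : ℝ) * π + π)) ^ ((2:ℝ)/3)) →
          (2:ℝ)/3 * x ^ ((3:ℝ)/2) ∈
            Icc (11*π/12 + (j : ℝ)*π - 5/(36*((j : ℝ)*π + 5*π/6)))
                (11*π/12 + (j : ℝ)*π + 5/(36*((j : ℝ)*π + 5*π/6)))) ∧
      -- (3) zeros of u
      (u (-x) = 0 →
          x ∈ Ioo (((3:ℝ)/2 * ((j : ℝ) * π + π/2)) ^ ((2:ℝ)/3))
                  (((3:ℝ)/2 * ((j : ℝ) * π + 2*π/3)) ^ ((2:ℝ)/3)) →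
          (2:ℝ)/3 * x ^ ((3:ℝ)/2) ∈
            Icc (7*π/12 + (j : ℝ)*π - 5/(36*((j : ℝ)*π + π/2)))
                (7*π/12 + (j : ℝ)*π + 5/(36*((j : ℝ)*π + π/2)))) ∧
      -- (4) zeros of u'
      (u' (-x) = 0 →
          x ∈ Ioo (((3:ℝ)/2 * ((j : ℝ) * π + π)) ^ ((2:ℝ)/3))
                  (((3:ℝ)/2 * ((j : ℝ) * π + 7*π/6)) ^ ((2:ℝ)/3)) →
          (2:ℝ)/3 * x ^ ((3:ℝ)/2) ∈
            Icc (13*π/12 + (j : ℝ)*π - 7/(12*((j : ℝ)+1)*π))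
                (13*π/12 + (j : ℝ)*π + 7/(12*((j : ℝ)+1)*π)))) := by
  have hpi := pi_pos
  obtain ⟨β, hβ⟩ := airy_reflected_eq_of_tendsto
    (fun x hx => hasDerivAt_im_const_mul _ (hasDerivAt_airyHankel hx))
    (fun x hx => (hasDerivAt_im_const_mul (Complex.exp (((π / 12 : ℝ) : ℂ) * Complex.I))
      (hasDerivAt_airyHankelDeriv hx)).congr_deriv (by
        rw [mul_neg, mul_left_comm, Complex.neg_im, Complex.im_ofReal_mul]))
    hu huAiry hv hvAiry hu0 hv0 hv'0 tendsto_im_airyHankel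
  obtain ⟨α, hα⟩ := airy_reflected_eq_of_tendsto_deriv
    (fun x hx => hasDerivAt_im_const_mul _ (hasDerivAt_airyHankelNeg hx))
    (fun x hx => (hasDerivAt_im_const_mul (Complex.exp (((-(7 * π / 12) : ℝ) : ℂ) * Complex.I))
      (hasDerivAt_airyHankelNegDeriv hx)).congr_deriv (by
        rw [mul_neg, mul_left_comm, Complex.neg_im, Complex.im_ofReal_mul]))
    hu huAiry hv hvAiry hu0 hu'0 hv0 hv'0 tendsto_im_airyHankelNegDeriv
  intro j x hx
  rw [← airyPhase.eq_1]
  have hj : (0 : ℝ) ≤ j * π := by positivity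
  refine ⟨fun hz hI => ?_, fun hz hI => ?_, fun hz hI => ?_, fun hz hI => ?_⟩
  · have h1 := lt_airyPhase (by positivity) hI.1
    have h2 := airyPhase_lt (by positivity) hx.le hI.2
    have h0 := (hβ x hx).2
    rw [hz, mul_zero, neg_zero] at h0
    refine mem_Icc_of_abs_sub_le ((airyHankelDeriv_zero_estimate (n := j + 1) hx
      (abs_le.2 ⟨by linarith, by linarith⟩) (by push_cast; ring) h0).trans ?_)
    have h3 : 1 < airyPhase x := by linarith [pi_gt_three]
    have h4 : 25 / 144 / airyPhase x ^ 2 ≤ 25 / 144 / airyPhase x := by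
      gcongr
      nlinarith
    calc _ ≤ 9 / 8 * (17 / 72 / airyPhase x + 25 / 144 / airyPhase x) := by gcongr
      _ = (9 / 8 * (17 / 72 + 25 / 144)) / airyPhase x := by ring
      _ ≤ (7 / 12) / (j * π + π / 3) :=
        div_le_div₀ (by norm_num) (by norm_num) (by positivity) h1.le
      _ = _ := by rw [div_div]
  · have h1 := lt_airyPhase (by positivity) hI.1
    have h2 := airyPhase_lt (by positivity) hx.le hI.2
    have h0 := (hβ x hx).1
    rw [hz, mul_zero] at h0
    refine mem_Icc_of_abs_sub_le ((airyHankel_zero_estimate (n := j + 1) hx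
      (abs_le.2 ⟨by linarith, by linarith⟩) (by push_cast; ring) h0).trans ?_)
    rw [← div_div]
    exact div_le_div₀ (by norm_num) (by norm_num) (by positivity) h1.le
  · have h1 := lt_airyPhase (by positivity) hI.1
    have h2 := airyPhase_lt (by positivity) hx.le hI.2
    have h0 := (hα x hx).1
    rw [hz, mul_zero] at h0
    refine mem_Icc_of_abs_sub_le ((airyHankelNeg_zero_estimate (n := j) hx
      (abs_le.2 ⟨by linarith, by linarith⟩) (by ring) h0).trans ?_)
    rw [← div_div]
    exact div_le_div₀ (by norm_num) (by norm_num) (by positivity) h1.le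
  · have h1 := lt_airyPhase (by positivity) hI.1
    have h2 := airyPhase_lt (by positivity) hx.le hI.2
    have h0 := (hα x hx).2
    rw [hz, mul_zero, neg_zero] at h0
    refine mem_Icc_of_abs_sub_le ((airyHankelNegDeriv_zero_estimate (n := j + 1) hx
      (abs_le.2 ⟨by linarith, by linarith⟩) (by push_cast; ring) h0).trans ?_)
    rw [mul_assoc, ← div_div]
    exact div_le_div₀ (by norm_num) (by norm_num) (by positivity) (by linarith)
end

section
/- For every c > 0 and every real E with E < −c (i.e. for energies below the minimum of the potential), none of the four band-edge equations has a solution: u'(−c−E)·v'(−E) ≠ v'(−c−E)·u'(−E); u(−E)·v(−c−E) ≠ v(−E)·u(−c−E); v(−E)·u'(−c−E) ≠ u(−E)·v'(−c−E); and v'(−E)·u(−c−E) ≠ u'(−E)·v(−c−E). (This is the reformulation, via the explicit characterization of the band edges, of the inclusion σ(H) ⊆ [−V₀, +∞) for the periodic Airy–Schrödinger operator.) -/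
open Real Set

/-- The Wronskian of two solutions of the Airy equation is constant. -/
theorem airy_wronskian_eq {u v u' v' : ℝ → ℝ}
    (hu : ∀ x, HasDerivAt u (u' x) x) (huAiry : ∀ x, HasDerivAt u' (x * u x) x)
    (hv : ∀ x, HasDerivAt v (v' x) x) (hvAiry : ∀ x, HasDerivAt v' (x * v x) x) (x y : ℝ) :
    u x * v' x - u' x * v x = u y * v' y - u' y * v y := by
  have h : ∀ x, HasDerivAt (fun x => u x * v' x - u' x * v x) 0 x := fun x => by
    exact (((hu x).mul (hvAiry x)).sub ((huAiry x).mul (hv x))).congr_deriv (by ring)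
  exact is_const_of_deriv_eq_zero (fun x => (h x).differentiableAt) (fun x => (h x).deriv) x y

/-- For a solution `f` of the Airy equation whose Cauchy data never vanish, `f * f'` is strictly
increasing on the positive half-line. -/
theorem airy_strictMonoOn_mul_deriv {f f' : ℝ → ℝ}
    (hf : ∀ x, HasDerivAt f (f' x) x) (hfAiry : ∀ x, HasDerivAt f' (x * f x) x)
    (hne : ∀ x, f x = 0 → f' x ≠ 0) : StrictMonoOn (fun x => f x * f' x) (Ioi 0) := by
  have h : ∀ x, HasDerivAt (fun x => f x * f' x) (f' x * f' x + f x * (x * f x)) x :=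
    fun x => (hf x).mul (hfAiry x)
  refine strictMonoOn_of_deriv_pos (convex_Ioi 0)
    (fun x _ => (h x).continuousAt.continuousWithinAt) fun x hx => ?_
  rw [interior_Ioi] at hx
  have hx : 0 < x := hx
  rw [(h x).deriv, mul_left_comm]
  by_cases hfx : f x = 0
  · simpa [hfx] using mul_self_pos.2 (hne x hfx)
  · exact add_pos_of_nonneg_of_pos (mul_self_nonneg _) (mul_pos hx (mul_self_pos.2 hfx))

theorem stmt_5 (u v u' v' : ℝ → ℝ)
    (hu : ∀ x, HasDerivAt u (u' x) x)
    (huAiry : ∀ x, HasDerivAt u' (x * u x) x)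
    (hv : ∀ x, HasDerivAt v (v' x) x)
    (hvAiry : ∀ x, HasDerivAt v' (x * v x) x)
    (hu0 : u 0 = 1) (hu'0 : u' 0 = 0) (hv0 : v 0 = 0) (hv'0 : v' 0 = 1) :
    ∀ c : ℝ, 0 < c → ∀ E : ℝ, E < -c →
      u' (-c - E) * v' (-E) ≠ v' (-c - E) * u' (-E) ∧
      u (-E) * v (-c - E) ≠ v (-E) * u (-c - E) ∧
      v (-E) * u' (-c - E) ≠ u (-E) * v' (-c - E) ∧
      v' (-E) * u (-c - E) ≠ u' (-E) * v (-c - E) := by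
  intro c hc E hE
  have wronskian : ∀ x, u x * v' x - u' x * v x = 1 := fun x => by
    rw [airy_wronskian_eq hu huAiry hv hvAiry x 0, hu0, hu'0, hv0, hv'0]
    norm_num
  have key : ∀ α β : ℝ, (α = 0 → β ≠ 0) →
      (α * u (-c - E) - β * v (-c - E)) * (α * u' (-c - E) - β * v' (-c - E)) <
        (α * u (-E) - β * v (-E)) * (α * u' (-E) - β * v' (-E)) := by
    intro α β hαβ
    refine airy_strictMonoOn_mul_deriv (f := fun x => α * u x - β * v x)
      (f' := fun x => α * u' x - β * v' x)
      (fun x => ((hu x).const_mul α).sub ((hv x).const_mul β))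
      (fun x => ?_) (fun x h h' => ?_) (mem_Ioi.2 (by linarith)) (mem_Ioi.2 (by linarith))
      (by linarith)
    · exact (((huAiry x).const_mul α).sub ((hvAiry x).const_mul β)).congr_deriv (by ring)
    · have w := wronskian x
      exact hαβ (by linear_combination v' x * h - v x * h' - α * w)
        (by linear_combination u' x * h - u x * h' - β * w)
  have wE := wronskian (-E)
  have dirichlet := key (v (-E)) (u (-E)) fun h h' => by simp [h, h'] at wE
  have neumann := key (v' (-E)) (u' (-E)) fun h h' => by simp [h, h'] at wE
  refine ⟨fun h => neumann.ne ?_, fun h => dirichlet.ne ?_, fun h => dirichlet.ne ?_,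
    fun h => neumann.ne ?_⟩
  · linear_combination (v' (-E) * u (-c - E) - u' (-E) * v (-c - E)) * h
  · linear_combination -(v (-E) * u' (-c - E) - u (-E) * v' (-c - E)) * h
  · linear_combination (v (-E) * u (-c - E) - u (-E) * v (-c - E)) * h
  · linear_combination (v' (-E) * u' (-c - E) - u' (-E) * v' (-c - E)) * h
end
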